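/- Let S = K[x_1,...,x_n] over a field K. If M is a monomial ideal of S containing a homogeneous regular sequence f_1,...,f_t with deg(f_i) = a_i and a_1 ≤ ... ≤ a_t, then there exists a monomial ideal J of S containing x_1^{a_1},...,x_t^{a_t} such that dim_K (S/J)_d = dim_K (S/M)_d for all d ≥ 0. -/

import Mathlib

set_option synthInstance.maxHeartbeats 1000000
set_option maxHeartbeats 1000000

open MvPolynomial

/-- `dim_K (S/I)_d`, the Hilbert function of `S/I` in degree `d`:
the `K`-dimension of `S_d / I_d`. -/
noncomputable def hilbertFn {n : ℕ} (K : Type*) [Field K]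
    (I : Ideal (MvPolynomial (Fin n) K)) (d : ℕ) : ℕ :=
  Module.finrank K
    (↥(homogeneousSubmodule (Fin n) K d) ⧸
      (Submodule.comap (homogeneousSubmodule (Fin n) K d).subtype
        (Submodule.restrictScalars K I)))

/-- A monomial ideal of `S = K[x₁,…,xₙ]`: an ideal generated by monomials. -/
def IsMonomialIdeal {n : ℕ} {K : Type*} [Field K] (I : Ideal (MvPolynomial (Fin n) K)) : Prop :=
  ∃ G : Set (Fin n →₀ ℕ), I = Ideal.span ((fun s => (monomial s (1 : K))) '' G)


namespace EGH
open Finset Function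
open scoped Classical

def lx {n : ℕ} (u v : Fin n → ℕ) : Prop := ∃ i, (∀ j < i, u j = v j) ∧ u i < v i

lemma lx_irrefl {n : ℕ} (u : Fin n → ℕ) : ¬ lx u u := by
  rintro ⟨i, _, h⟩; omega

lemma lx_trans {n : ℕ} {u v w : Fin n → ℕ} (h1 : lx u v) (h2 : lx v w) : lx u w := by
  obtain ⟨i, hi, hi'⟩ := h1
  obtain ⟨j, hj, hj'⟩ := h2
  rcases lt_trichotomy i j with h | h | h
  · exact ⟨i, fun k hk => (hi k hk).trans (hj k (hk.trans h)), by rw [← hj i h]; exact hi'⟩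
  · subst h
    exact ⟨i, fun k hk => (hi k hk).trans (hj k hk), hi'.trans hj'⟩
  · exact ⟨j, fun k hk => (hi k (hk.trans h)).trans (hj k hk), by rw [hi j h]; exact hj'⟩

lemma lx_tri {n : ℕ} (u v : Fin n → ℕ) : lx u v ∨ u = v ∨ lx v u := by
  by_cases h : u = v
  · exact Or.inr (Or.inl h)
  · have hne : (univ.filter (fun i => u i ≠ v i)).Nonempty := by
      obtain ⟨i, hi⟩ := Function.ne_iff.mp h
      exact ⟨i, by simpa using hi⟩
    set i := (univ.filter (fun i => u i ≠ v i)).min' hne with hi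
    have h1 : u i ≠ v i := by
      have := Finset.min'_mem _ hne
      rw [← hi] at this
      simpa using this
    have h2 : ∀ j < i, u j = v j := by
      intro j hj
      by_contra hc
      have := Finset.min'_le (univ.filter (fun i => u i ≠ v i)) j (by simpa using hc)
      rw [← hi] at this
      exact absurd hj (not_lt.mpr this)
    rcases lt_or_gt_of_ne h1 with h3 | h3
    · exact Or.inl ⟨i, h2, h3⟩
    · exact Or.inr (Or.inr ⟨i, fun j hj => (h2 j hj).symm, h3⟩)

lemma lx_asymm {n : ℕ} {u v : Fin n → ℕ} (h : lx u v) : ¬ lx v u := fun h' =>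
  lx_irrefl _ (lx_trans h h')

def dg {n : ℕ} (u : Fin n → ℕ) : ℤ := ∑ i, (u i : ℤ)

noncomputable def bx {n : ℕ} (a : Fin n → ℕ) : Finset (Fin n → ℕ) :=
  Fintype.piFinset fun i => Finset.range (a i)

lemma mem_bx {n : ℕ} {a u : Fin n → ℕ} : u ∈ bx a ↔ ∀ i, u i < a i := by
  simp [bx]

noncomputable def PP {n : ℕ} (a : Fin n → ℕ) (d : ℤ) : Finset (Fin n → ℕ) :=
  (bx a).filter (fun u => dg u = d)

lemma mem_PP {n : ℕ} {a u : Fin n → ℕ} {d : ℤ} : u ∈ PP a d ↔ (∀ i, u i < a i) ∧ dg u = d := by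
  simp [PP, mem_bx]

noncomputable def up {n : ℕ} (a : Fin n → ℕ) (A : Finset (Fin n → ℕ)) : Finset (Fin n → ℕ) :=
  (bx a).filter (fun w => ∃ u ∈ A, ∃ j, w = u + Pi.single j 1)

lemma mem_up {n : ℕ} {a w : Fin n → ℕ} {A : Finset (Fin n → ℕ)} :
    w ∈ up a A ↔ (∀ i, w i < a i) ∧ ∃ u ∈ A, ∃ j, w = u + Pi.single j 1 := by
  simp [up, mem_bx]

def UC {n : ℕ} (a : Fin n → ℕ) (d : ℤ) (A : Finset (Fin n → ℕ)) : Prop :=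
  A ⊆ PP a d ∧ ∀ u ∈ A, ∀ v ∈ PP a d, lx u v → v ∈ A

noncomputable def seg {n : ℕ} (X : Finset (Fin n → ℕ)) (s : ℕ) : Finset (Fin n → ℕ) :=
  X.filter (fun u => (X.filter (fun w => lx u w)).card < s)

lemma rank_lt {n : ℕ} {X : Finset (Fin n → ℕ)} {u v : Fin n → ℕ} (hv : v ∈ X) (h : lx u v) :
    (X.filter (fun w => lx v w)).card < (X.filter (fun w => lx u w)).card := by
  apply Finset.card_lt_card
  rw [Finset.ssubset_iff_of_subset]
  · exact ⟨v, by simp [hv, h], by simp [lx_irrefl]⟩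
  · intro w hw
    simp only [mem_filter] at hw ⊢
    exact ⟨hw.1, lx_trans h hw.2⟩

lemma seg_subset {n : ℕ} (X : Finset (Fin n → ℕ)) (s : ℕ) : seg X s ⊆ X := filter_subset _ _

lemma seg_card {n : ℕ} {X : Finset (Fin n → ℕ)} {s : ℕ} (hs : s ≤ X.card) :
    (seg X s).card = s := by
  set r : (Fin n → ℕ) → ℕ := fun u => (X.filter (fun w => lx u w)).card with hr
  have hinj : Set.InjOn r X := by
    intro u hu v hv huv
    rcases lx_tri u v with h | h | h
    · exact absurd huv (rank_lt hv h).ne'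
    · exact h
    · exact absurd huv (rank_lt hu h).ne
  have himg : X.image r = range X.card := by
    apply Finset.eq_of_subset_of_card_le
    · intro k hk
      obtain ⟨u, hu, rfl⟩ := Finset.mem_image.mp hk
      rw [mem_range]
      apply Finset.card_lt_card
      rw [Finset.ssubset_iff_of_subset (filter_subset _ _)]
      exact ⟨u, hu, by simp [lx_irrefl]⟩
    · rw [Finset.card_image_of_injOn hinj, card_range]
  have h1 : (seg X s).image r = range s := by
    ext k
    simp only [mem_image, mem_range]
    constructor
    · rintro ⟨u, hu, rfl⟩
      exact (mem_filter.mp hu).2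
    · intro hk
      have : k ∈ X.image r := by rw [himg, mem_range]; omega
      obtain ⟨u, hu, rfl⟩ := Finset.mem_image.mp this
      exact ⟨u, mem_filter.mpr ⟨hu, hk⟩, rfl⟩
  rw [← Finset.card_image_of_injOn (hinj.mono (by exact_mod_cast seg_subset X s)), h1, card_range]

lemma seg_UC {n : ℕ} (a : Fin n → ℕ) (d : ℤ) (s : ℕ) : UC a d (seg (PP a d) s) := by
  refine ⟨seg_subset _ _, fun u hu v hv h => ?_⟩
  simp only [seg, mem_filter] at hu ⊢
  exact ⟨hv, (rank_lt hv h).trans hu.2⟩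

lemma UC_subset {n : ℕ} {a : Fin n → ℕ} {d : ℤ} {A B : Finset (Fin n → ℕ)} (hA : UC a d A)
    (hB : UC a d B) (h : A.card ≤ B.card) : A ⊆ B := by
  by_contra hc
  obtain ⟨u, hu, hu'⟩ := Finset.not_subset.mp hc
  have : B ⊂ A := by
    rw [Finset.ssubset_iff_of_subset]
    · exact ⟨u, hu, hu'⟩
    · intro v hv
      rcases lx_tri u v with h | h | h
      · exact hA.2 u hu v (hB.1 hv) h
      · exact absurd (h ▸ hv) hu'
      · exact absurd (hB.2 v hv u (hA.1 hu) h) hu'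
  exact absurd (card_lt_card this) (by omega)

lemma UC_union_card {n : ℕ} {a : Fin n → ℕ} {d : ℤ} {A B : Finset (Fin n → ℕ)} (hA : UC a d A)
    (hB : UC a d B) : (A ∪ B).card = max A.card B.card := by
  rcases le_total A.card B.card with h | h
  · rw [union_eq_right.mpr (UC_subset hA hB h), max_eq_right h]
  · rw [union_eq_left.mpr (UC_subset hB hA h), max_eq_left h]

lemma dg_add {n : ℕ} (u v : Fin n → ℕ) : dg (u + v) = dg u + dg v := by
  simp [dg, Finset.sum_add_distrib]

lemma dg_single {n : ℕ} (j : Fin n) (k : ℕ) : dg (Pi.single j k) = k := by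
  simp only [dg]
  rw [Finset.sum_eq_single j]
  · simp
  · intro b _ hb; simp [hb]
  · simp

lemma dg_nonneg {n : ℕ} (u : Fin n → ℕ) : 0 ≤ dg u := Finset.sum_nonneg (fun _ _ => by positivity)

lemma eq_of_le_dg {n : ℕ} {u v : Fin n → ℕ} (h : ∀ i, u i ≤ v i) (hd : dg v ≤ dg u) : u = v := by
  by_contra hc
  obtain ⟨i, hi⟩ := Function.ne_iff.mp hc
  have : dg u < dg v := Finset.sum_lt_sum (fun i _ => by exact_mod_cast h i)
    ⟨i, mem_univ _, by exact_mod_cast lt_of_le_of_ne (h i) hi⟩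
  omega

lemma dg_update {n : ℕ} (u : Fin n → ℕ) (i : Fin n) (k : ℕ) :
    dg (update u i k) = dg u - u i + k := by
  have h1 : update u i k + Pi.single i (u i) = u + Pi.single i k := by
    ext j
    by_cases h : j = i
    · subst h; simp; omega
    · simp [h]
  have := congrArg dg h1
  rw [dg_add, dg_add, dg_single, dg_single] at this
  omega

lemma up_UC {n : ℕ} {a : Fin n → ℕ} {d : ℤ} {L : Finset (Fin n → ℕ)} (hL : UC a d L) :
    UC a (d + 1) (up a L) := by
  constructor
  · intro w hw
    obtain ⟨h1, u, hu, j, rfl⟩ := mem_up.mp hw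
    rw [mem_PP, dg_add, dg_single, (mem_PP.mp (hL.1 hu)).2]
    exact ⟨h1, by simp⟩
  · intro w hw w' hw' hlt
    obtain ⟨h1, u, hu, j, rfl⟩ := mem_up.mp hw
    rw [mem_PP] at hw'
    obtain ⟨i, hi, hi'⟩ := hlt
    have hle : ∀ k, u k ≤ (u + Pi.single j 1 : Fin n → ℕ) k := by intro k; simp
    have hne : (univ.filter (fun k => 0 < w' k)).Nonempty := ⟨i, by simp; omega⟩
    set m := (univ.filter (fun k => 0 < w' k)).max' hne with hm
    have hm1 : 0 < w' m := by
      have := Finset.max'_mem _ hne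
      rw [← hm] at this
      simpa using this
    have hm2 : ∀ k, m < k → w' k = 0 := by
      intro k hk
      by_contra hc
      have := Finset.le_max' (univ.filter (fun k => 0 < w' k)) k (by simp; omega)
      rw [← hm] at this
      exact absurd hk (not_lt.mpr this)
    have him : i ≤ m := by
      by_contra hc
      have := hm2 i (not_le.mp hc)
      omega
    set u' := update w' m (w' m - 1) with hu'
    have hdu : dg u = d := (mem_PP.mp (hL.1 hu)).2
    have hu'P : u' ∈ PP a d := by
      rw [mem_PP, hu', dg_update, hw'.2]
      refine ⟨fun k => ?_, by omega⟩
      have := hw'.1 k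
      by_cases hk : k = m
      · subst hk; simp; omega
      · simp [hk]; omega
    have key : u' ∈ L := by
      rcases lx_tri u u' with h | h | h
      · exact hL.2 u hu u' hu'P h
      · exact h ▸ hu
      · exfalso
        obtain ⟨l, hl, hl'⟩ := h
        have hge : ∀ k ≤ i, u k ≤ u' k := by
          intro k hk
          have h3 := hle k
          by_cases hkm : k = m
          · have : k = i := le_antisymm hk (hkm ▸ him)
            subst this
            rw [hu', hkm]; simp; rw [← hkm]; omega
          · rw [hu']; simp only [ne_eq, hkm, not_false_eq_true, update_of_ne]
            rcases hk.lt_or_eq with h | h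
            · rw [← hi k h]; exact h3
            · rw [h] at h3 ⊢; omega
        have hil : i < l := by
          by_contra hc
          have := hge l (not_lt.mp hc)
          omega
        have him' : m = i := by
          by_contra hne'
          have h4 := hl i hil
          rw [hu'] at h4
          simp only [ne_eq, Ne.symm hne', not_false_eq_true, update_of_ne] at h4
          have := hle i
          omega
        have : u' = u := by
          apply eq_of_le_dg
          · intro k
            rcases le_or_gt k i with h | h
            · exact (hl k (lt_of_le_of_lt h hil)).le
            · have : k ≠ m := by rw [him']; exact h.ne'
              rw [hu']; simp only [ne_eq, this, not_false_eq_true, update_of_ne]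
              rw [hm2 k (him' ▸ h)]; omega
          · rw [hdu, (mem_PP.mp hu'P).2]
        rw [this] at hl'
        omega
    refine mem_up.mpr ⟨hw'.1, u', key, m, ?_⟩
    ext k
    by_cases hk : k = m
    · subst hk; simp [hu']; omega
    · simp [hu', hk]

/-! slices -/

noncomputable def sl {n : ℕ} (a : Fin n → ℕ) (i : Fin n) (k : ℕ) (A : Finset (Fin n → ℕ)) :
    Finset (Fin n → ℕ) := (bx (update a i 1)).filter (fun u => update u i k ∈ A)

lemma mem_sl {n : ℕ} {a : Fin n → ℕ} {i : Fin n} {k : ℕ} {A : Finset (Fin n → ℕ)}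
    {u : Fin n → ℕ} : u ∈ sl a i k A ↔ (u i = 0 ∧ ∀ j ≠ i, u j < a j) ∧ update u i k ∈ A := by
  simp only [sl, mem_filter, mem_bx]
  refine and_congr_left fun _ => ⟨fun h => ⟨by simpa using h i, fun j hj => by simpa [hj] using h j⟩,
    fun h j => ?_⟩
  by_cases hj : j = i
  · subst hj; simp [h.1]
  · simpa [hj] using h.2 j hj

lemma sl_sub {n : ℕ} {a : Fin n → ℕ} {i : Fin n} {k : ℕ} {A : Finset (Fin n → ℕ)} {d : ℤ}
    (hA : A ⊆ PP a d) : sl a i k A ⊆ PP (update a i 1) (d - k) := by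
  intro u hu
  have h2 := mem_sl.mp hu
  have h3 := (mem_PP.mp (hA h2.2)).2
  rw [dg_update, h2.1.1] at h3
  refine mem_PP.mpr ⟨mem_bx.mp (mem_filter.mp hu).1, by push_cast at h3; omega⟩

lemma card_sl {n : ℕ} {a : Fin n → ℕ} (i : Fin n) {A : Finset (Fin n → ℕ)}
    (hA : A ⊆ bx a) : A.card = ∑ k ∈ range (a i), (sl a i k A).card := by
  rw [Finset.card_eq_sum_card_fiberwise (f := fun u => u i) (t := range (a i))]
  · apply Finset.sum_congr rfl
    intro k _
    refine Finset.card_bij' (fun u _ => update u i 0) (fun u _ => update u i k) ?_ ?_ ?_ ?_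
    · intro u hu
      simp only [mem_filter] at hu
      rw [mem_sl]
      refine ⟨⟨by simp, fun j hj => ?_⟩, ?_⟩
      · simp [hj]; exact mem_bx.mp (hA hu.1) j
      · simp [← hu.2, hu.1]
    · intro u hu
      simp only [mem_filter]
      exact ⟨(mem_sl.mp hu).2, by simp⟩
    · intro u hu
      simp only [mem_filter] at hu
      simp [← hu.2]
    · intro u hu
      have := (mem_sl.mp hu).1.1
      simp [← this]
  · intro u hu
    have := mem_bx.mp (hA hu) i
    simpa using this

lemma PP_sl {n : ℕ} {a : Fin n → ℕ} (i : Fin n) {k : ℕ} (hk : k < a i) (d : ℤ) :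
    sl a i k (PP a d) = PP (update a i 1) (d - k) := by
  apply Finset.Subset.antisymm (sl_sub (Subset.refl _))
  intro u hu
  have h := mem_PP.mp hu
  have hi : u i = 0 := by simpa using h.1 i
  have hj : ∀ j ≠ i, u j < a j := fun j hj => by simpa [hj] using h.1 j
  rw [mem_sl, mem_PP]
  refine ⟨⟨hi, hj⟩, fun j => ?_, ?_⟩
  · by_cases hji : j = i
    · subst hji; simpa using hk
    · simpa [hji] using hj j hji
  · rw [dg_update, h.2, hi]; push_cast; omega

lemma card_PP {n : ℕ} {a : Fin n → ℕ} (i : Fin n) (d : ℤ) :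
    (PP a d).card = ∑ k ∈ range (a i), (PP (update a i 1) (d - k)).card := by
  have h : PP a d ⊆ bx a := filter_subset _ _
  rw [card_sl i h]
  exact Finset.sum_congr rfl (fun k hk => by rw [PP_sl i (mem_range.mp hk)])

lemma sl_up {n : ℕ} {a : Fin n → ℕ} (i : Fin n) {k : ℕ} (hk : k < a i) {A : Finset (Fin n → ℕ)}
    (hA : A ⊆ bx a) :
    sl a i k (up a A) = up (update a i 1) (sl a i k A) ∪ (if k = 0 then ∅ else sl a i (k-1) A) := by
  ext w
  simp only [mem_union]
  constructor
  · intro hw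
    obtain ⟨⟨h1, h2⟩, h3⟩ := mem_sl.mp hw
    obtain ⟨h4, u, hu, j, h5⟩ := mem_up.mp h3
    have hub := mem_bx.mp (hA hu)
    have hoff : ∀ l ≠ i, w l = (u + Pi.single j 1 : Fin n → ℕ) l := by
      intro l hl; rw [← h5]; simp [hl]
    have hon : k = (u + Pi.single j 1 : Fin n → ℕ) i := by rw [← h5]; simp
    by_cases hj : j = i
    · right
      subst hj
      simp at hon
      rw [if_neg (by omega), mem_sl]
      refine ⟨⟨h1, h2⟩, ?_⟩
      convert hu
      ext l
      by_cases hl : l = j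
      · subst hl; simp; omega
      · have := hoff l hl; simp [hl] at this; simp [hl, this]
    · left
      rw [mem_up]
      have hui : u i = k := by simp [Ne.symm hj] at hon; omega
      refine ⟨fun l => ?_, update u i 0, ?_, j, ?_⟩
      · by_cases hl : l = i
        · subst hl; simp [h1]
        · simpa [hl] using h2 l hl
      · rw [mem_sl]
        refine ⟨⟨by simp, fun l hl => by simpa [hl] using hub l⟩, by simpa [← hui] using hu⟩
      · ext l
        by_cases hl : l = i
        · subst hl; simp [h1, Ne.symm hj]
        · have := hoff l hl; simp [hl, this]
  · rintro (h | h)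
    · obtain ⟨h4, u, hu, j, h5⟩ := mem_up.mp h
      obtain ⟨⟨h1, h2⟩, h3⟩ := mem_sl.mp hu
      have hwi : w i = 0 := by simpa using h4 i
      have hj : j ≠ i := by
        rintro rfl
        rw [h5] at hwi; simp at hwi
      have hwb : ∀ l ≠ i, w l < a l := fun l hl => by simpa [hl] using h4 l
      rw [mem_sl, mem_up]
      refine ⟨⟨hwi, hwb⟩, fun l => ?_, _, h3, j, ?_⟩
      · by_cases hl : l = i
        · subst hl; simpa using hk
        · simpa [hl] using hwb l hl
      · ext l
        by_cases hl : l = i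
        · subst hl; simp [Ne.symm hj]
        · simp [hl, h5]
    · by_cases hk0 : k = 0
      · simp [hk0] at h
      · rw [if_neg hk0] at h
        obtain ⟨⟨h1, h2⟩, h3⟩ := mem_sl.mp h
        rw [mem_sl, mem_up]
        refine ⟨⟨h1, h2⟩, fun l => ?_, _, h3, i, ?_⟩
        · by_cases hl : l = i
          · subst hl; simpa using hk
          · simpa [hl] using h2 l hl
        · ext l
          by_cases hl : l = i
          · subst hl; simp; omega
          · simp [hl]

lemma up_sub_bx {n : ℕ} (a : Fin n → ℕ) (A) : up a A ⊆ bx a := filter_subset _ _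

lemma build {n : ℕ} (a : Fin n → ℕ) (i : Fin n) (d : ℤ) (C : ℕ → Finset (Fin n → ℕ))
    (c' : ℕ → ℕ)
    (hC : ∀ k < a i, UC (update a i 1) (d - k) (C k))
    (hc : ∀ k < a i, (up (update a i 1) (C k)).card ≤ c' k)
    (hc' : ∀ k, k + 1 < a i → (C k).card ≤ c' (k + 1)) :
    ∃ A ⊆ PP a d, (∀ k < a i, sl a i k A = C k) ∧ A.card = ∑ k ∈ range (a i), (C k).card ∧
      (up a A).card ≤ ∑ k ∈ range (a i), c' k := by
  set A := (bx a).filter (fun u => update u i 0 ∈ C (u i)) with hA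
  have hAb : A ⊆ bx a := filter_subset _ _
  have hsl : ∀ k < a i, sl a i k A = C k := by
    intro k hk
    ext u
    rw [mem_sl, hA, mem_filter, mem_bx]
    simp only [update_idem, update_self]
    constructor
    · rintro ⟨⟨h1, h2⟩, h3, h4⟩
      rwa [← h1, update_eq_self] at h4
    · intro hu
      have h := (mem_PP.mp ((hC k hk).1 hu)).1
      have hui : u i = 0 := by simpa using h i
      have hj : ∀ j ≠ i, u j < a j := fun j hj => by simpa [hj] using h j
      refine ⟨⟨hui, hj⟩, fun j => ?_, ?_⟩
      · by_cases hl : j = i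
        · subst hl; simpa using hk
        · simpa [hl] using hj j hl
      · rwa [← hui, update_eq_self]
  refine ⟨A, ?_, hsl, ?_, ?_⟩
  · intro u hu
    obtain ⟨h1, h2⟩ := mem_filter.mp hu
    have h3 := mem_bx.mp h1
    have h4 := (mem_PP.mp ((hC _ (h3 i)).1 h2)).2
    rw [dg_update] at h4
    exact mem_PP.mpr ⟨h3, by push_cast at h4; omega⟩
  · rw [card_sl i hAb]
    exact Finset.sum_congr rfl (fun k hk => by rw [hsl k (mem_range.mp hk)])
  · rw [card_sl i (up_sub_bx a A)]
    apply Finset.sum_le_sum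
    intro k hk
    rw [mem_range] at hk
    rw [sl_up i hk hAb, hsl k hk]
    split_ifs with h0
    · simpa using hc k hk
    · rw [hsl (k-1) (by omega)]
      have h1 := up_UC (hC k hk)
      have h2 := hC (k-1) (by omega)
      have : d - (k:ℤ) + 1 = d - ((k - 1 : ℕ) : ℤ) := by omega
      rw [← this] at h2
      rw [UC_union_card h1 h2]
      apply max_le (hc k hk)
      have := hc' (k-1) (by omega)
      rwa [show k - 1 + 1 = k by omega] at this

end EGH


namespace EGH
open Finset Function
open scoped Classical

lemma sum_sl {n : ℕ} {a : Fin n → ℕ} (i : Fin n) {A : Finset (Fin n → ℕ)}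
    (hA : A ⊆ bx a) (f : (Fin n → ℕ) → ℕ) :
    ∑ u ∈ A, f u = ∑ k ∈ range (a i), ∑ u ∈ sl a i k A, f (update u i k) := by
  rw [← Finset.sum_fiberwise_of_maps_to (g := fun u => u i) (t := range (a i))]
  · apply Finset.sum_congr rfl
    intro k _
    refine Finset.sum_bij' (fun u _ => update u i 0) (fun u _ => update u i k) ?_ ?_ ?_ ?_ ?_
    · intro u hu
      simp only [mem_filter] at hu
      rw [mem_sl]
      refine ⟨⟨by simp, fun j hj => ?_⟩, ?_⟩
      · simp [hj]; exact mem_bx.mp (hA hu.1) j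
      · simp [← hu.2, hu.1]
    · intro u hu
      simp only [mem_filter]
      exact ⟨(mem_sl.mp hu).2, by simp⟩
    · intro u hu
      simp only [mem_filter] at hu
      simp [← hu.2]
    · intro u hu
      have := (mem_sl.mp hu).1.1
      simp [← this]
    · intro u hu
      simp only [mem_filter] at hu
      simp [← hu.2]
  · intro u hu
    have := mem_bx.mp (hA hu) i
    simpa using this

lemma sum_UC_lt {n : ℕ} {a : Fin n → ℕ} {d : ℤ} {C X : Finset (Fin n → ℕ)} (hC : UC a d C)
    (hX : X ⊆ PP a d) (hcard : C.card = X.card) (f : (Fin n → ℕ) → ℕ)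
    (hf : ∀ u ∈ PP a d, ∀ v ∈ PP a d, lx u v → f v < f u) :
    ∑ u ∈ C, f u ≤ ∑ u ∈ X, f u ∧ (C ≠ X → ∑ u ∈ C, f u < ∑ u ∈ X, f u) := by
  by_cases h : C = X
  · subst h; exact ⟨le_refl _, fun h => absurd rfl h⟩
  · suffices hlt : ∑ u ∈ C, f u < ∑ u ∈ X, f u from ⟨hlt.le, fun _ => hlt⟩
    have hc : (C \ X).card = (X \ C).card := by
      have h1 := Finset.card_sdiff_add_card_inter C X
      have h2 := Finset.card_sdiff_add_card_inter X C
      rw [inter_comm] at h2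
      omega
    have hne : (X \ C).Nonempty := by
      rw [Finset.sdiff_nonempty]
      intro hs
      exact h (Finset.eq_of_subset_of_card_le hs hcard.le).symm
    have hlt : ∀ t ∈ C \ X, ∀ x ∈ X \ C, f t < f x := by
      intro t ht x hx
      rw [mem_sdiff] at ht hx
      apply hf x (hX hx.1) t (hC.1 ht.1)
      rcases lx_tri x t with h | h | h
      · exact h
      · exact absurd (h ▸ ht.1) hx.2
      · exact absurd (hC.2 t ht.1 x (hX hx.1) h) hx.2
    obtain ⟨x0, hx0, hmin⟩ := Finset.exists_min_image (X \ C) f hne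
    have hne' : (C \ X).Nonempty := by
      rw [← Finset.card_pos, hc, Finset.card_pos]; exact hne
    have h1 : ∑ u ∈ C \ X, f u < (C \ X).card • f x0 := by
      rw [← Finset.sum_const]
      exact Finset.sum_lt_sum_of_nonempty hne' (fun t ht => hlt t ht x0 hx0)
    have h2 : (X \ C).card • f x0 ≤ ∑ u ∈ X \ C, f u := by
      rw [← Finset.sum_const]
      exact Finset.sum_le_sum hmin
    have h3 := Finset.sum_inter_add_sum_sdiff C X f
    have h4 := Finset.sum_inter_add_sum_sdiff X C f
    rw [inter_comm] at h4
    rw [hc] at h1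
    omega

/-- compressed set in the same class -/
lemma exists_compressed {n : ℕ} (a : Fin n → ℕ) (d : ℤ)
    (IH : ∀ i, 1 < a i → ∀ e : ℤ, ∀ A ⊆ PP (update a i 1) e,
      (up (update a i 1) (seg (PP (update a i 1) e) A.card)).card ≤ (up (update a i 1) A).card)
    (A0 : Finset (Fin n → ℕ)) (hA0 : A0 ⊆ PP a d) :
    ∃ A ⊆ PP a d, A.card = A0.card ∧ (up a A).card ≤ (up a A0).card ∧
      ∀ i, 1 < a i → ∀ u ∈ A, ∀ v ∈ PP a d, lx u v → u i = v i → v ∈ A := by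
  set rk : (Fin n → ℕ) → ℕ := fun u => ((PP a d).filter (fun w => lx u w)).card with hrk
  set S := (PP a d).powerset.filter
    (fun A => A.card = A0.card ∧ (up a A).card ≤ (up a A0).card) with hS
  have hne : S.Nonempty := ⟨A0, by simp [hS, hA0]⟩
  obtain ⟨A, hA, hmin⟩ := Finset.exists_min_image S (fun A => ∑ u ∈ A, rk u) hne
  simp only [hS, mem_filter, mem_powerset] at hA
  obtain ⟨hAP, hAc, hAu⟩ := hA
  refine ⟨A, hAP, hAc, hAu, fun i hi => ?_⟩
  have hAb : A ⊆ bx a := hAP.trans (filter_subset _ _)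
  set C : ℕ → Finset (Fin n → ℕ) :=
    fun k => seg (PP (update a i 1) (d - k)) (sl a i k A).card with hCd
  have hCUC : ∀ k : ℕ, UC (update a i 1) (d - k) (C k) := fun k => seg_UC _ _ _
  have hCcard : ∀ k, (C k).card = (sl a i k A).card :=
    fun k => seg_card (card_le_card (sl_sub hAP))
  obtain ⟨B, hBP, hBs, hBc, hBu⟩ := build a i d C (fun k => (sl a i k (up a A)).card)
    (fun k _ => hCUC k)
    (fun k hk => by
      refine (IH i hi (d - k) _ (sl_sub hAP)).trans (card_le_card ?_)
      rw [sl_up i hk hAb]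
      exact subset_union_left)
    (fun k hk => by
      rw [hCcard]
      apply card_le_card
      rw [sl_up i hk hAb]
      simp)
  have hBS : B ∈ S := by
    simp only [hS, mem_filter, mem_powerset]
    refine ⟨hBP, ?_, ?_⟩
    · rw [hBc, ← hAc, card_sl i hAb]
      exact Finset.sum_congr rfl (fun k _ => hCcard k)
    · rw [← card_sl i (up_sub_bx a A)] at hBu
      omega
  have hle := hmin B hBS
  have hf : ∀ k < a i, ∀ u ∈ PP (update a i 1) (d - k), ∀ v ∈ PP (update a i 1) (d - k),
      lx u v → rk (update v i k) < rk (update u i k) := by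
    intro k hk u hu v hv huv
    rw [← PP_sl i hk] at hv hu
    have hv' := mem_sl.mp hv
    have hu' := mem_sl.mp hu
    apply rank_lt hv'.2
    obtain ⟨j, hj, hj'⟩ := huv
    have hji : j ≠ i := by rintro rfl; rw [hv'.1.1] at hj'; omega
    refine ⟨j, fun l hl => ?_, by simpa [hji] using hj'⟩
    by_cases hli : l = i
    · subst hli; simp
    · simpa [hli] using hj l hl
  have hall : ∀ k < a i, C k = sl a i k A := by
    by_contra hcon
    push Not at hcon
    obtain ⟨k0, hk0, hne0⟩ := hcon
    have : ∑ u ∈ B, rk u < ∑ u ∈ A, rk u := by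
      rw [sum_sl i (hBP.trans (filter_subset _ _)), sum_sl i hAb]
      apply Finset.sum_lt_sum
      · intro k hk
        rw [mem_range] at hk
        rw [hBs k hk]
        exact (sum_UC_lt (hCUC k) (sl_sub hAP) (hCcard k) _ (hf k hk)).1
      · refine ⟨k0, mem_range.mpr hk0, ?_⟩
        rw [hBs k0 hk0]
        exact (sum_UC_lt (hCUC k0) (sl_sub hAP) (hCcard k0) _ (hf k0 hk0)).2 hne0
    omega
  intro u hu v hv huv hiv
  have hk := mem_bx.mp (hAb hu) i
  have h1 : update u i 0 ∈ sl a i (u i) A := by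
    rw [mem_sl]
    exact ⟨⟨by simp, fun j hj => by simpa [hj] using mem_bx.mp (hAb hu) j⟩, by simpa using hu⟩
  have h2 : update v i 0 ∈ sl a i (u i) (PP a d) := by
    rw [mem_sl, hiv]
    exact ⟨⟨by simp, fun j hj => by simpa [hj] using (mem_PP.mp hv).1 j⟩, by simpa using hv⟩
  rw [PP_sl i hk] at h2
  rw [← hall _ hk] at h1
  have h3 := (hCUC (u i)).2 _ h1 _ h2 (by
    obtain ⟨j, hj, hj'⟩ := huv
    have hji : j ≠ i := by rintro rfl; omega
    refine ⟨j, fun l hl => ?_, by simpa [hji] using hj'⟩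
    by_cases hli : l = i
    · subst hli; simp
    · simpa [hli] using hj l hl)
  rw [hall _ hk, mem_sl] at h3
  rw [hiv] at h3
  simpa using h3.2

lemma lx_of_move {n : ℕ} {u v : Fin n → ℕ} {i j : Fin n} (hij : i < j)
    (h : v + Pi.single j 1 = u + Pi.single i 1) : lx u v := by
  refine ⟨i, fun k hk => ?_, ?_⟩
  · have := congrFun h k
    simpa [hk.ne, (hk.trans hij).ne] using this.symm
  · have := congrFun h i
    simp [hij.ne] at this
    omega

noncomputable def TT {n : ℕ} (a : Fin n → ℕ) (A : Finset (Fin n → ℕ)) (m : Fin n) :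
    Finset (Fin n → ℕ) := A.filter (fun u => (∀ j, m < j → u j = 0) ∧ u m + 1 < a m)

lemma up_card {n : ℕ} {a : Fin n → ℕ} {d : ℤ} {A : Finset (Fin n → ℕ)} (hA : A ⊆ PP a d)
    (hB : ∀ u ∈ A, ∀ v ∈ PP a d, ∀ i j, i < j → v + Pi.single j 1 = u + Pi.single i 1 → v ∈ A) :
    (up a A).card = ∑ m, (TT a A m).card := by
  have h1 : up a A = univ.biUnion (fun m => (TT a A m).image (fun u => u + Pi.single m 1)) := by
    ext w
    simp only [mem_biUnion, mem_univ, true_and, mem_image]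
    constructor
    · intro hw
      obtain ⟨h1, u, hu, j, hj⟩ := mem_up.mp hw
      have hne : (univ.filter (fun k => 0 < w k)).Nonempty := ⟨j, by simp [hj]⟩
      set m := (univ.filter (fun k => 0 < w k)).max' hne with hm
      have hm1 : 0 < w m := by
        have := Finset.max'_mem _ hne
        rw [← hm] at this
        simpa using this
      have hm2 : ∀ k, m < k → w k = 0 := by
        intro k hk
        by_contra hc
        have := Finset.le_max' (univ.filter (fun k => 0 < w k)) k (by simp; omega)
        rw [← hm] at this
        exact absurd hk (not_lt.mpr this)
      have hjm : j ≤ m := by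
        by_contra hc
        have := hm2 j (not_le.mp hc)
        rw [hj] at this; simp at this
      have hv : update w m (w m - 1) + Pi.single m 1 = w := by
        ext k
        by_cases hk : k = m
        · subst hk; simp; omega
        · simp [hk]
      refine ⟨m, update w m (w m - 1), mem_filter.mpr ⟨?_, ?_, ?_⟩, hv⟩
      · rcases hjm.lt_or_eq with h | h
        · apply hB u hu _ _ j m h (hv.trans hj)
          rw [mem_PP]
          have h2 := (mem_PP.mp (hA hu)).2
          have h3 := congrArg dg (hv.trans hj)
          rw [dg_add, dg_add, dg_single, dg_single] at h3
          refine ⟨fun k => ?_, by omega⟩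
          have := h1 k
          by_cases hk : k = m
          · subst hk; simp; omega
          · simpa [hk]
        · have := hv.trans hj
          rw [h] at this
          rw [add_right_cancel this]
          exact hu
      · intro k hk
        simp [hk.ne', hm2 k hk]
      · have := h1 m
        simp; omega
    · rintro ⟨m, u, hu, rfl⟩
      obtain ⟨hu1, hu2, hu3⟩ := mem_filter.mp hu
      refine mem_up.mpr ⟨fun k => ?_, u, hu1, m, rfl⟩
      have := (mem_PP.mp (hA hu1)).1 k
      by_cases hk : k = m
      · subst hk; simpa using hu3
      · simpa [hk] using this
  rw [h1, Finset.card_biUnion]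
  · apply Finset.sum_congr rfl
    intro m _
    apply Finset.card_image_of_injective
    intro u v huv
    exact add_right_cancel huv
  · have key : ∀ m m' : Fin n, m < m' → Disjoint ((TT a A m).image (fun u => u + Pi.single m 1))
        ((TT a A m').image (fun u => u + Pi.single m' 1)) := by
      intro m m' hlt
      rw [Finset.disjoint_left]
      intro w hw hw'
      obtain ⟨u, hu, rfl⟩ := mem_image.mp hw
      obtain ⟨u', hu', he⟩ := mem_image.mp hw'
      have := congrFun he m'
      have h2 := (mem_filter.mp hu).2.1 m' hlt
      simp [hlt.ne', h2] at this
    intro m _ m' _ hne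
    rcases lt_or_gt_of_ne hne with h | h
    · exact key m m' h
    · exact (key m' m h).symm

lemma alpha {n : ℕ} {a : Fin n → ℕ} {d : ℤ} {A : Finset (Fin n → ℕ)} {z : Fin n} (hA : A ⊆ PP a d)
    (hz : ∀ j, z < j → a j ≤ 1)
    (hB : ∀ u ∈ A, ∀ v ∈ PP a d, ∀ i j, i < j → v + Pi.single j 1 = u + Pi.single i 1 → v ∈ A)
    (hcz : ∀ u ∈ A, ∀ v ∈ PP a d, lx u v → u z = v z → v ∈ A)
    (v : Fin n → ℕ) (hv : v ∈ PP a d) (hvz : v z = 0) :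
    ∀ k, ∀ u ∈ A, u z = k → lx u v → v ∈ A := by
  intro k
  induction k with
  | zero => intro u hu huz huv; exact hcz u hu v hv huv (by omega)
  | succ k ih =>
    intro u hu huz huv
    have huP := mem_PP.mp (hA hu)
    have hvP := mem_PP.mp hv
    obtain ⟨i, hi, hi'⟩ := huv
    have hiz : i < z := by
      by_contra hc
      rcases (not_lt.mp hc).lt_or_eq with h | h
      · have := hz i h; have := hvP.1 i; omega
      · subst h; omega
    have hne : (univ.filter (fun l => l < z ∧ u l + 1 < a l)).Nonempty :=
      ⟨i, by have := hvP.1 i; simp [hiz]; omega⟩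
    set j := (univ.filter (fun l => l < z ∧ u l + 1 < a l)).max' hne with hj
    have hj1 : j < z ∧ u j + 1 < a j := by
      have := Finset.max'_mem _ hne
      rw [← hj] at this
      simpa using this
    have hj2 : ∀ l, j < l → l < z → a l ≤ u l + 1 := by
      intro l hl hlz
      by_contra hc
      have := Finset.le_max' (univ.filter (fun l => l < z ∧ u l + 1 < a l)) l
        (by simp [hlz]; omega)
      rw [← hj] at this
      exact absurd hl (not_lt.mpr this)
    have hij : i ≤ j := Finset.le_max' (univ.filter (fun l => l < z ∧ u l + 1 < a l)) i
      (by have := hvP.1 i; simp [hiz]; omega)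
    set u1 := update (update u j (u j + 1)) z k with hu1
    have hu1z : u1 z = k := by simp [hu1]
    have hu1j : u1 j = u j + 1 := by simp [hu1, hj1.1.ne]
    have hu1o : ∀ l, l ≠ j → l ≠ z → u1 l = u l := fun l h1 h2 => by simp [hu1, h1, h2]
    have hmove : u1 + Pi.single z 1 = u + Pi.single j 1 := by
      ext l
      by_cases h1 : l = z
      · subst h1; simp [hu1z, huz, hj1.1.ne']
      · by_cases h2 : l = j
        · subst h2; simp [hu1j, h1]
        · simp [h1, h2, hu1o l h2 h1]
    have hdg : dg u1 = d := by
      have h3 := congrArg dg hmove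
      rw [dg_add, dg_add, dg_single, dg_single] at h3
      omega
    have hu1P : u1 ∈ PP a d := by
      rw [mem_PP]
      refine ⟨fun l => ?_, hdg⟩
      have := huP.1 l
      by_cases h1 : l = z
      · subst h1; omega
      · by_cases h2 : l = j
        · subst h2; omega
        · rw [hu1o l h2 h1]; omega
    have hu1A : u1 ∈ A := hB u hu u1 hu1P j z hj1.1 hmove
    have hcase : u1 = v ∨ lx u1 v := by
      rcases hij.lt_or_eq with h | h
      · right
        refine ⟨i, fun l hl => ?_, ?_⟩
        · rw [hu1o l (hl.trans h).ne (hl.trans hiz).ne]; exact hi l hl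
        · rw [hu1o i h.ne hiz.ne]; exact hi'
      · by_cases hlt : u1 i < v i
        · right
          refine ⟨i, fun l hl => ?_, hlt⟩
          rw [hu1o l (h ▸ hl.ne) (hl.trans hiz).ne]; exact hi l hl
        · left
          symm
          apply eq_of_le_dg
          · intro l
            rcases lt_trichotomy l i with hl | hl | hl
            · rw [hu1o l (h ▸ hl.ne) (hl.trans hiz).ne, hi l hl]
            · subst hl; omega
            · rcases lt_trichotomy l z with hl' | hl' | hl'
              · have h5 := hj2 l (h ▸ hl) hl'
                have h6 := hvP.1 l
                rw [hu1o l (h ▸ hl.ne') hl'.ne]; omega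
              · subst hl'; omega
              · have := hz l hl'; have := hvP.1 l; omega
          · rw [hdg, hvP.2]
    rcases hcase with h | h
    · exact h ▸ hu1A
    · exact ih u1 hu1A hu1z h

lemma beta {n : ℕ} {a : Fin n → ℕ} {d : ℤ} {A : Finset (Fin n → ℕ)} {z : Fin n} (hA : A ⊆ PP a d)
    (hz : ∀ j, z < j → a j ≤ 1)
    (hB : ∀ u ∈ A, ∀ v ∈ PP a d, ∀ i j, i < j → v + Pi.single j 1 = u + Pi.single i 1 → v ∈ A)
    (hcz : ∀ u ∈ A, ∀ v ∈ PP a d, lx u v → u z = v z → v ∈ A)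
    (v : Fin n → ℕ) (hv : v ∈ A) (hvz : v z + 1 = a z) :
    ∀ k, ∀ w ∈ PP a d, w z + k = v z → lx v w → w ∈ A := by
  intro k
  induction k with
  | zero => intro w hw hwz hvw; exact hcz v hv w hw hvw (by omega)
  | succ k ih =>
    intro w hw hwz hvw
    have hwP := mem_PP.mp hw
    have hvP := mem_PP.mp (hA hv)
    obtain ⟨i, hi, hi'⟩ := hvw
    have hiz : i < z := by
      by_contra hc
      rcases (not_lt.mp hc).lt_or_eq with h | h
      · have := hz i h; have := hwP.1 i; omega
      · subst h; omega
    have hne : (univ.filter (fun l => l < z ∧ 0 < w l)).Nonempty :=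
      ⟨i, by simp [hiz]; omega⟩
    set j := (univ.filter (fun l => l < z ∧ 0 < w l)).max' hne with hj
    have hj1 : j < z ∧ 0 < w j := by
      have := Finset.max'_mem _ hne
      rw [← hj] at this
      simpa using this
    have hj2 : ∀ l, j < l → l < z → w l = 0 := by
      intro l hl hlz
      by_contra hc
      have := Finset.le_max' (univ.filter (fun l => l < z ∧ 0 < w l)) l
        (by simp [hlz]; omega)
      rw [← hj] at this
      exact absurd hl (not_lt.mpr this)
    have hij : i ≤ j := Finset.le_max' (univ.filter (fun l => l < z ∧ 0 < w l)) i
      (by simp [hiz]; omega)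
    set w1 := update (update w j (w j - 1)) z (w z + 1) with hw1
    have hw1z : w1 z = w z + 1 := by simp [hw1]
    have hw1j : w1 j = w j - 1 := by simp [hw1, hj1.1.ne]
    have hw1o : ∀ l, l ≠ j → l ≠ z → w1 l = w l := fun l h1 h2 => by simp [hw1, h1, h2]
    have hmove : w + Pi.single z 1 = w1 + Pi.single j 1 := by
      ext l
      by_cases h1 : l = z
      · subst h1; simp [hw1z, hj1.1.ne']
      · by_cases h2 : l = j
        · subst h2; simp [hw1j, h1]; omega
        · simp [h1, h2, hw1o l h2 h1]
    have hdg : dg w1 = d := by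
      have h3 := congrArg dg hmove
      rw [dg_add, dg_add, dg_single, dg_single] at h3
      omega
    have hw1P : w1 ∈ PP a d := by
      rw [mem_PP]
      refine ⟨fun l => ?_, hdg⟩
      have := hwP.1 l
      by_cases h1 : l = z
      · subst h1; omega
      · by_cases h2 : l = j
        · subst h2; omega
        · rw [hw1o l h2 h1]; omega
    have hcase : w1 = v ∨ lx v w1 := by
      rcases hij.lt_or_eq with h | h
      · right
        refine ⟨i, fun l hl => ?_, ?_⟩
        · rw [hw1o l (hl.trans h).ne (hl.trans hiz).ne]; exact hi l hl
        · rw [hw1o i h.ne hiz.ne]; exact hi'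
      · by_cases hlt : v i < w1 i
        · right
          refine ⟨i, fun l hl => ?_, hlt⟩
          rw [hw1o l (h ▸ hl.ne) (hl.trans hiz).ne]; exact hi l hl
        · left
          apply eq_of_le_dg
          · intro l
            rcases lt_trichotomy l i with hl | hl | hl
            · rw [hw1o l (h ▸ hl.ne) (hl.trans hiz).ne, hi l hl]
            · subst hl; omega
            · rcases lt_trichotomy l z with hl' | hl' | hl'
              · have h5 := hj2 l (h ▸ hl) hl'
                rw [hw1o l (h ▸ hl.ne') hl'.ne]; omega
              · subst hl'; omega
              · have := hz l hl'; have := (mem_PP.mp hw1P).1 l; omega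
          · rw [hdg, hvP.2]
    have hw1A : w1 ∈ A := by
      rcases hcase with h | h
      · exact h ▸ hv
      · exact ih w1 hw1P (by omega) h
    exact hB w1 hw1A w hw j z hj1.1 hmove

lemma UC_borel {n : ℕ} {a : Fin n → ℕ} {d : ℤ} {A : Finset (Fin n → ℕ)} (hA : UC a d A) :
    ∀ u ∈ A, ∀ v ∈ PP a d, ∀ i j, i < j → v + Pi.single j 1 = u + Pi.single i 1 → v ∈ A :=
  fun u hu v hv _ _ hij h => hA.2 u hu v hv (lx_of_move hij h)

lemma comp_case {n : ℕ} {a : Fin n → ℕ} {d : ℤ} {A L : Finset (Fin n → ℕ)} (hA : A ⊆ PP a d)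
    (hL : UC a d L) (hcard : L.card = A.card)
    (h3 : 3 ≤ (univ.filter (fun i => 1 < a i)).card)
    (hc : ∀ i, 1 < a i → ∀ u ∈ A, ∀ v ∈ PP a d, lx u v → u i = v i → v ∈ A) :
    (up a L).card ≤ (up a A).card := by
  have hB : ∀ u ∈ A, ∀ v ∈ PP a d, ∀ i j, i < j → v + Pi.single j 1 = u + Pi.single i 1 →
      v ∈ A := by
    intro u hu v hv i j hij h
    have : ({i, j} : Finset (Fin n)).card < (univ.filter (fun i => 1 < a i)).card :=
      lt_of_le_of_lt Finset.card_le_two h3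
    obtain ⟨l, hl, hl'⟩ := Finset.exists_mem_notMem_of_card_lt_card this
    simp at hl hl'
    apply hc l hl u hu v hv (lx_of_move hij h)
    have := congrFun h l
    simpa [hl'.1, hl'.2] using this.symm
  have hne : (univ.filter (fun i => 1 < a i)).Nonempty := by
    rw [← Finset.card_pos]; omega
  set z := (univ.filter (fun i => 1 < a i)).max' hne with hz
  have hz1 : 1 < a z := by
    have := Finset.max'_mem _ hne
    rw [← hz] at this
    simpa using this
  have hz2 : ∀ k, z < k → a k ≤ 1 := by
    intro k hk
    by_contra hc
    have := Finset.le_max' (univ.filter (fun i => 1 < a i)) k (by simp; omega)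
    rw [← hz] at this
    exact absurd hk (not_lt.mpr this)
  have hα : ∀ v ∈ L, v z = 0 → v ∈ A := by
    intro v hv hvz
    by_contra hvA
    have : A ⊂ L := by
      rw [Finset.ssubset_iff_of_subset]
      · exact ⟨v, hv, hvA⟩
      · intro u hu
        rcases lx_tri u v with h | h | h
        · exact absurd (alpha hA hz2 hB (hc z hz1) v (hL.1 hv) hvz _ u hu rfl h) hvA
        · exact h ▸ hv
        · exact hL.2 v hv u (hA hu) h
    exact absurd (card_lt_card this) (by omega)
  have hβ : ∀ v ∈ A, v z + 1 = a z → v ∈ L := by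
    intro v hv hvz
    by_contra hvL
    have : L ⊂ A := by
      rw [Finset.ssubset_iff_of_subset]
      · exact ⟨v, hv, hvL⟩
      · intro w hw
        rcases lx_tri v w with h | h | h
        · have := (mem_PP.mp (hL.1 hw)).1 z
          exact beta hA hz2 hB (hc z hz1) v hv hvz (v z - w z) w (hL.1 hw) (by omega) h
        · exact h ▸ hv
        · exact absurd (hL.2 w hw v (hA hv) h) hvL
    exact absurd (card_lt_card this) (by omega)
  rw [up_card hL.1 (UC_borel hL), up_card hA hB]
  apply Finset.sum_le_sum
  intro m _
  rcases lt_trichotomy m z with h | h | h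
  · apply card_le_card
    intro u hu
    obtain ⟨h1, h2, h4⟩ := mem_filter.mp hu
    exact mem_filter.mpr ⟨hα u h1 (h2 z h), h2, h4⟩
  · subst h
    have heq : ∀ X ⊆ PP a d, TT a X z = X.filter (fun u => ¬ (u z + 1 = a z)) := by
      intro X hX
      apply Finset.filter_congr
      intro u hu
      have h5 := (mem_PP.mp (hX hu)).1
      constructor
      · rintro ⟨_, h⟩; omega
      · intro h
        refine ⟨fun j hj => ?_, ?_⟩
        · have := hz2 j hj; have := h5 j; omega
        · have := h5 z; omega
    rw [heq L hL.1, heq A hA]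
    have e1 := Finset.card_filter_add_card_filter_not (s := L) (fun u => u z + 1 = a z)
    have e2 := Finset.card_filter_add_card_filter_not (s := A) (fun u => u z + 1 = a z)
    have e3 : (A.filter (fun u => u z + 1 = a z)).card ≤
        (L.filter (fun u => u z + 1 = a z)).card := by
      apply card_le_card
      intro u hu
      obtain ⟨h1, h2⟩ := mem_filter.mp hu
      exact mem_filter.mpr ⟨hβ u h1 h2, h2⟩
    omega
  · have : TT a L m = ∅ := by
      apply Finset.filter_eq_empty_iff.mpr
      rintro u hu ⟨_, h4⟩
      have := hz2 m h
      omega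
    simp [this]

end EGH


namespace EGH
open Finset Function
open scoped Classical

lemma two_case {n : ℕ} {a : Fin n → ℕ} {d : ℤ} {A L : Finset (Fin n → ℕ)} (hA : A ⊆ PP a d)
    (hL : UC a d L) (hcard : L.card = A.card) {p q : Fin n} (hpq : p < q) (hle : a p ≤ a q)
    (hoth : ∀ k, k ≠ p → k ≠ q → a k ≤ 1) :
    (up a L).card ≤ (up a A).card := by
  by_cases hfull : A = PP a d
  · have : L = PP a d := Finset.eq_of_subset_of_card_le hL.1 (by rw [hcard, hfull])
    rw [this, hfull]
  by_cases hemp : A = ∅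
  · have : L = ∅ := by rw [← Finset.card_eq_zero, hcard, hemp]; simp
    rw [this, hemp]
  obtain ⟨v, hv, hvA⟩ : ∃ v ∈ PP a d, v ∉ A := by
    by_contra hc
    push Not at hc
    exact hfull (Finset.Subset.antisymm hA hc)
  have hAne := Finset.nonempty_iff_ne_empty.mpr hemp
  -- basic facts
  have hdeg : ∀ u : Fin n → ℕ, (∀ i, u i < a i) → dg u = (u p : ℤ) + u q := by
    intro u hu
    have : u = Pi.single p (u p) + Pi.single q (u q) := by
      ext k
      by_cases h1 : k = p
      · subst h1; simp [hpq.ne]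
      · by_cases h2 : k = q
        · subst h2; simp [h1]
        · have := hoth k h1 h2; have := hu k; simp [h1, h2]; omega
    conv_lhs => rw [this]
    rw [dg_add, dg_single, dg_single]
  have hext : ∀ u w : Fin n → ℕ, (∀ i, u i < a i) → (∀ i, w i < a i) → u p = w p → u q = w q →
      u = w := by
    intro u w hu hw h1 h2
    ext k
    by_cases hk : k = p
    · rw [hk, h1]
    · by_cases hk' : k = q
      · rw [hk', h2]
      · have := hoth k hk hk'; have := hu k; have := hw k; omega
  have hAf : ∀ u ∈ A, (∀ i, u i < a i) ∧ (u p : ℤ) + u q = d := by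
    intro u hu
    have := mem_PP.mp (hA hu)
    exact ⟨this.1, by rw [← hdeg u this.1]; exact this.2⟩
  have hvP := mem_PP.mp hv
  have hvd : (v p : ℤ) + v q = d := by rw [← hdeg v hvP.1]; exact hvP.2
  -- upper bound for L
  have hupd : ∀ w ∈ up a L, (w p : ℤ) + w q = d + 1 := by
    intro w hw
    have := mem_PP.mp ((up_UC hL).1 hw)
    rw [← hdeg w this.1]; exact this.2
  have hinj : Set.InjOn (fun u : Fin n → ℕ => u + Pi.single q 1) (L : Set (Fin n → ℕ)) := by
    intro u _ w _ h
    exact add_right_cancel h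
  have hstep : ∀ w ∈ up a L, 0 < w q → w ∈ L.image (fun u => u + Pi.single q 1) := by
    intro w hw hwq
    have hwd := hupd w hw
    obtain ⟨hw1, u, hu, j, hj⟩ := mem_up.mp hw
    have huP := mem_PP.mp (hL.1 hu)
    have hud : (u p : ℤ) + u q = d := by rw [← hdeg u huP.1]; exact huP.2
    have hw' : update w q (w q - 1) + Pi.single q 1 = w := by
      ext k
      by_cases hk : k = q
      · subst hk; simp; omega
      · simp [hk]
    refine mem_image.mpr ⟨update w q (w q - 1), ?_, hw'⟩
    have hbd : ∀ i, update w q (w q - 1) i < a i := by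
      intro i
      have := hw1 i
      by_cases hk : i = q
      · subst hk; simp; omega
      · simpa [hk]
    have hP : update w q (w q - 1) ∈ PP a d := by
      rw [mem_PP, hdeg _ hbd]
      refine ⟨hbd, ?_⟩
      simp [hpq.ne]; omega
    have hup : u p ≤ w p := by rw [hj]; simp
    rcases hup.lt_or_eq with h | h
    · apply hL.2 u hu _ hP
      refine ⟨p, fun k hk => ?_, by simpa [hpq.ne] using h⟩
      have h1 := hoth k hk.ne (hk.trans hpq).ne
      have h2 := huP.1 k
      have h3 := hbd k
      omega
    · have : update w q (w q - 1) = u := by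
        apply hext _ _ hbd huP.1
        · simp [hpq.ne, h]
        · simp; omega
      rw [this]; exact hu
  have hLc : (L.image (fun u => u + Pi.single q 1)).card = A.card := by
    rw [Finset.card_image_of_injOn hinj, hcard]
  by_cases hd : (a p : ℤ) ≤ d + 1
  · -- |up L| ≤ |L|, |A| ≤ |up A|
    have h1 : (up a L).card ≤ A.card := by
      rw [← hLc]
      apply card_le_card
      intro w hw
      apply hstep w hw
      have := hupd w hw
      have := (mem_up.mp hw).1 p
      omega
    refine h1.trans ?_
    apply Finset.card_le_card_of_injOn
      (fun u => if v p < u p then u + Pi.single q 1 else u + Pi.single p 1)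
    · intro u hu
      have hu : u ∈ A := hu
      have hf := hAf u hu
      have hne : u p ≠ v p := by
        intro h
        apply hvA
        rw [← hext u v hf.1 hvP.1 h (by omega)]; exact hu
      have h2 := hvP.1 p
      have h4 := hvP.1 q
      show _ ∈ up a A
      beta_reduce
      rw [mem_up]
      split_ifs with h
      · refine ⟨fun k => ?_, u, hu, q, rfl⟩
        have := hf.1 k
        by_cases hk : k = q
        · subst hk; simp; omega
        · simpa [hk]
      · refine ⟨fun k => ?_, u, hu, p, rfl⟩
        have := hf.1 k
        by_cases hk : k = p
        · subst hk; simp; omega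
        · simpa [hk]
    · intro u hu w hw h
      have hu : u ∈ A := hu
      have hw : w ∈ A := hw
      have hf := hAf u hu
      have hg := hAf w hw
      have hne : u p ≠ v p := by
        intro h
        apply hvA
        rw [← hext u v hf.1 hvP.1 h (by omega)]; exact hu
      have hne' : w p ≠ v p := by
        intro h
        apply hvA
        rw [← hext w v hg.1 hvP.1 h (by omega)]; exact hw
      simp only at h
      split_ifs at h with h5 h6 h6
      · exact add_right_cancel h
      · have := congrFun h p
        simp [hpq.ne] at this; omega
      · have := congrFun h p
        simp [hpq.ne] at this; omega
      · exact add_right_cancel h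
  · -- no truncation
    have h1 : (up a L).card ≤ A.card + 1 := by
      rw [← hLc]
      set w0 : Fin n → ℕ := Pi.single p (d + 1).toNat with hw0
      refine (card_le_card (t := insert w0 (L.image (fun u => u + Pi.single q 1))) ?_).trans
        (Finset.card_insert_le _ _)
      intro w hw
      rw [mem_insert]
      by_cases h : 0 < w q
      · right; exact hstep w hw h
      · left
        have h2 := hupd w hw
        have h4 := (mem_up.mp hw).1
        ext k
        by_cases hk : k = p
        · subst hk; simp [hw0]; omega
        · by_cases hk' : k = q
          · subst hk'; simp [hw0, hk]; omega
          · have := hoth k hk hk'; have := h4 k; simp [hw0, hk]; omega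
    refine h1.trans ?_
    obtain ⟨u0, hu0, hmax⟩ := Finset.exists_max_image A (fun u => u p) hAne
    have hnot : u0 + Pi.single p 1 ∉ A.image (fun u => u + Pi.single q 1) := by
      intro h
      obtain ⟨u, hu, he⟩ := mem_image.mp h
      have := congrFun he p
      simp [hpq.ne] at this
      have := hmax u hu
      omega
    have hc2 : (insert (u0 + Pi.single p 1) (A.image (fun u => u + Pi.single q 1))).card
        = A.card + 1 := by
      rw [Finset.card_insert_of_notMem hnot, Finset.card_image_of_injective]
      intro u w h
      exact add_right_cancel h
    rw [← hc2]
    apply card_le_card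
    intro w hw
    rw [mem_insert, mem_image] at hw
    rcases hw with rfl | ⟨u, hu, rfl⟩
    · have hf := hAf u0 hu0
      refine mem_up.mpr ⟨fun k => ?_, u0, hu0, p, rfl⟩
      have := hf.1 k
      by_cases hk : k = p
      · subst hk; simp; omega
      · simpa [hk]
    · have hf := hAf u hu
      refine mem_up.mpr ⟨fun k => ?_, u, hu, q, rfl⟩
      have := hf.1 k
      by_cases hk : k = q
      · subst hk; simp; omega
      · simpa [hk]

lemma one_case {n : ℕ} {a : Fin n → ℕ} {d : ℤ} {A L : Finset (Fin n → ℕ)} (hA : A ⊆ PP a d)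
    (hL : UC a d L) (hcard : L.card = A.card)
    (h1 : (univ.filter (fun i => 1 < a i)).card ≤ 1) :
    (up a L).card ≤ (up a A).card := by
  have hP : (PP a d).card ≤ 1 := by
    rw [Finset.card_le_one]
    intro u hu v hv
    by_contra hne
    obtain ⟨i, hi⟩ := Function.ne_iff.mp hne
    rw [mem_PP] at hu hv
    have hi1 : 1 < a i := by have := hu.1 i; have := hv.1 i; omega
    have : u = update v i (u i) := by
      ext k
      by_cases hk : k = i
      · subst hk; simp
      · have : ¬ 1 < a k := by
          intro hk1
          exact hk (Finset.card_le_one.mp h1 k (by simpa using hk1) i (by simpa using hi1))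
        have := hu.1 k; have := hv.1 k
        simp [hk]; omega
    have h2 := congrArg dg this
    rw [dg_update] at h2
    omega
  have : L = A := by
    by_cases h : A = ∅
    · rw [h] at hcard ⊢; simpa using hcard
    · have hAn : 0 < A.card := Finset.card_pos.mpr (Finset.nonempty_iff_ne_empty.mpr h)
      rw [Finset.eq_of_subset_of_card_le hL.1 (by omega),
        Finset.eq_of_subset_of_card_le hA (by omega)]
  rw [this]

theorem CL {n : ℕ} : ∀ m : ℕ, ∀ a : Fin n → ℕ, (univ.filter (fun i => 1 < a i)).card = m →
    (∀ i j, i < j → 1 < a i → 1 < a j → a i ≤ a j) → ∀ d : ℤ, ∀ A ⊆ PP a d,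
    (up a (seg (PP a d) A.card)).card ≤ (up a A).card := by
  intro m
  induction m with
  | zero =>
    intro a hm _ d A hA
    exact one_case hA (seg_UC _ _ _) (seg_card (card_le_card hA)) (by omega)
  | succ m ih =>
    intro a hm hs d A hA
    have hLc := seg_card (card_le_card hA)
    rcases Nat.lt_or_ge (m + 1) 2 with h | h
    · exact one_case hA (seg_UC _ _ _) hLc (by omega)
    rcases h.lt_or_eq with h | h
    · obtain ⟨A', hA', hc', hu', hcomp⟩ := exists_compressed a d (by
        intro i hi e B hB
        apply ih _ _ _ _ _ hB
        · have : univ.filter (fun j => 1 < update a i 1 j) =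
              (univ.filter (fun j => 1 < a j)).erase i := by
            ext j
            by_cases hj : j = i
            · subst hj; simp
            · simp [hj]
          rw [this, Finset.card_erase_of_mem (by simpa using hi), hm]; rfl
        · intro j k hjk h1 h2
          by_cases hj : j = i
          · subst hj; simp at h1
          · by_cases hk : k = i
            · subst hk; simp at h2
            · simp [hj, hk] at h1 h2 ⊢
              exact hs j k hjk h1 h2) A hA
      exact (comp_case hA' (seg_UC _ _ _) (hLc.trans hc'.symm) (by omega) hcomp).trans hu'
    · rw [← h, Finset.card_eq_two] at hm
      obtain ⟨x, y, hxy, he⟩ := hm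
      have hmem : ∀ k, 1 < a k ↔ k = x ∨ k = y := by
        intro k
        have := Finset.ext_iff.mp he k
        simpa using this
      rcases lt_or_gt_of_ne hxy with hlt | hlt
      · refine two_case hA (seg_UC _ _ _) hLc hlt
          (hs x y hlt ((hmem x).mpr (Or.inl rfl)) ((hmem y).mpr (Or.inr rfl))) ?_
        intro k h1 h2
        have := (hmem k).not.mpr (by tauto)
        omega
      · refine two_case hA (seg_UC _ _ _) hLc hlt
          (hs y x hlt ((hmem y).mpr (Or.inr rfl)) ((hmem x).mpr (Or.inl rfl))) ?_
        intro k h1 h2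
        have := (hmem k).not.mpr (by tauto)
        omega

end EGH


namespace EGH
open Finset Function
open scoped Classical

noncomputable def mon {n : ℕ} (Y : Finset (Fin n)) (e : ℤ) : Finset (Fin n → ℕ) :=
  (bx (fun _ => e.toNat + 1)).filter (fun u => (∀ j, j ∉ Y → u j = 0) ∧ dg u = e)

lemma le_dg {n : ℕ} (u : Fin n → ℕ) (i : Fin n) : (u i : ℤ) ≤ dg u :=
  Finset.single_le_sum (f := fun i => (u i : ℤ)) (fun _ _ => by positivity) (mem_univ i)

lemma mem_mon {n : ℕ} {Y : Finset (Fin n)} {e : ℤ} {u : Fin n → ℕ} :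
    u ∈ mon Y e ↔ (∀ j, j ∉ Y → u j = 0) ∧ dg u = e := by
  simp only [mon, mem_filter, mem_bx, and_iff_right_iff_imp]
  rintro ⟨_, h⟩ i
  have := le_dg u i
  omega

noncomputable def hh {n : ℕ} (N : Set (Fin n → ℕ)) (Y : Finset (Fin n)) (e : ℤ) : ℕ :=
  ((mon Y e).filter (fun u => u ∉ N)).card

lemma hh_anti {n : ℕ} {N N' : Set (Fin n → ℕ)} (h : N ⊆ N') (Y : Finset (Fin n)) (e : ℤ) :
    hh N' Y e ≤ hh N Y e := by
  apply card_le_card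
  intro u hu
  rw [mem_filter] at hu ⊢
  exact ⟨hu.1, fun hc => hu.2 (h hc)⟩

def col {n : ℕ} (N : Set (Fin n → ℕ)) (y : Fin n) : Set (Fin n → ℕ) :=
  {u | u + Pi.single y 1 ∈ N}

lemma col_upper {n : ℕ} {N : Set (Fin n → ℕ)} (hN : IsUpperSet N) (y : Fin n) :
    IsUpperSet (col N y) := by
  intro u v huv hu
  exact hN (add_le_add_left huv _) hu

lemma sub_col {n : ℕ} {N : Set (Fin n → ℕ)} (hN : IsUpperSet N) (y : Fin n) :
    N ⊆ col N y := by
  intro u hu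
  exact hN (by simp) hu

lemma hh_rec {n : ℕ} (N : Set (Fin n → ℕ)) {Y : Finset (Fin n)} {y : Fin n} (hy : y ∈ Y) (e : ℤ) :
    hh N Y e = hh N (Y.erase y) e + hh (col N y) Y (e - 1) := by
  unfold hh
  rw [← Finset.card_filter_add_card_filter_not (s := (mon Y e).filter (fun u => u ∉ N))
    (fun u => u y = 0)]
  congr 1
  · congr 1
    ext u
    simp only [mem_filter, mem_mon, mem_erase]
    constructor
    · rintro ⟨⟨⟨h1, h2⟩, h3⟩, h4⟩
      refine ⟨⟨fun j hj => ?_, h2⟩, h3⟩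
      by_cases hjy : j = y
      · rw [hjy, h4]
      · exact h1 j (fun h => hj ⟨hjy, h⟩)
    · rintro ⟨⟨h1, h2⟩, h3⟩
      exact ⟨⟨⟨fun j hj => h1 j (fun h => hj h.2), h2⟩, h3⟩, h1 y (by simp)⟩
  · refine Finset.card_bij' (fun u _ => update u y (u y - 1)) (fun u _ => u + Pi.single y 1)
      ?_ ?_ ?_ ?_
    · intro u hu
      simp only [mem_filter, mem_mon] at hu ⊢
      obtain ⟨⟨⟨h1, h2⟩, h3⟩, h4⟩ := hu
      have hv : update u y (u y - 1) + Pi.single y 1 = u := by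
        ext k
        by_cases hk : k = y
        · subst hk; simp; omega
        · simp [hk]
      refine ⟨⟨fun j hj => ?_, ?_⟩, ?_⟩
      · have : j ≠ y := fun h => hj (h ▸ hy)
        simp [this, h1 j hj]
      · rw [dg_update, h2]; omega
      · simp only [col, Set.mem_ofPred_eq]
        rwa [hv]
    · intro u hu
      simp only [mem_filter, mem_mon] at hu ⊢
      obtain ⟨⟨h1, h2⟩, h3⟩ := hu
      refine ⟨⟨⟨fun j hj => ?_, ?_⟩, h3⟩, by simp⟩
      · have : j ≠ y := fun h => hj (h ▸ hy)
        simp [this, h1 j hj]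
      · rw [dg_add, dg_single, h2]; simp
    · intro u hu
      simp only [mem_filter] at hu
      ext k
      by_cases hk : k = y
      · subst hk; simp; omega
      · simp [hk]
    · intro u hu
      ext k
      by_cases hk : k = y
      · subst hk; simp
      · simp [hk]

lemma greedy {n : ℕ} (Y : Finset (Fin n)) : ∀ q : ℕ, ∀ Q : Multiset (Fin n), Q.card = q →
    (∀ y ∈ Q, y ∈ Y) → ∀ N : Set (Fin n → ℕ), IsUpperSet N →
    (Q.map (fun y => (Pi.single y 1 : Fin n → ℕ))).sum ∈ N → ∀ e : ℤ,
    ∃ H H' : ℕ → ℕ, hh N Y e = ∑ k ∈ range q, H k ∧ hh N Y (e + 1) = ∑ k ∈ range q, H' k ∧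
      (∀ k < q, ∃ N', IsUpperSet N' ∧ N ⊆ N' ∧ ∃ y ∈ Q, H k = hh N' (Y.erase y) (e - k) ∧
        H' k = hh N' (Y.erase y) (e + 1 - k)) ∧
      ∀ k, k + 1 < q → H' (k + 1) ≤ H k := by
  intro q
  induction q with
  | zero =>
    intro Q hQ _ N hN hQN e
    rw [Multiset.card_eq_zero] at hQ
    subst hQ
    simp only [Multiset.map_zero, Multiset.sum_zero] at hQN
    have hall : ∀ u, u ∈ N := fun u => hN (zero_le : (0 : Fin n → ℕ) ≤ u) hQN
    refine ⟨fun _ => 0, fun _ => 0, ?_, ?_, ?_, ?_⟩ <;> simp [hh, hall]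
  | succ q ih =>
    intro Q hQ hQY N hN hQN e
    have hne : Q.toFinset.Nonempty := by
      rw [Multiset.toFinset_nonempty]
      rintro rfl
      simp at hQ
    obtain ⟨y, hy, hmax⟩ := Finset.exists_max_image Q.toFinset (fun y => hh N (Y.erase y) e) hne
    rw [Multiset.mem_toFinset] at hy
    have hcons := Multiset.cons_erase hy
    have hyY := hQY y hy
    obtain ⟨H, H', h1, h2, h3, h4⟩ := ih (Q.erase y)
      (by rw [Multiset.card_erase_of_mem hy, hQ]; rfl)
      (fun z hz => hQY z (Multiset.mem_of_mem_erase hz)) (col N y) (col_upper hN y)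
      (by
        rw [← hcons, Multiset.map_cons, Multiset.sum_cons, add_comm] at hQN
        exact hQN) (e - 1)
    refine ⟨fun k => Nat.casesOn k (hh N (Y.erase y) e) H,
      fun k => Nat.casesOn k (hh N (Y.erase y) (e + 1)) H', ?_, ?_, ?_, ?_⟩
    · rw [Finset.sum_range_succ', hh_rec N hyY, h1, add_comm]
      rfl
    · rw [Finset.sum_range_succ', hh_rec N hyY, add_comm]
      rw [show e + 1 - 1 = e - 1 + 1 by ring, h2]
      rfl
    · intro k hk
      cases k with
      | zero => exact ⟨N, hN, le_refl _, y, hy, by simp, by simp⟩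
      | succ k =>
        obtain ⟨N', hN', hs, z, hz, e1, e2⟩ := h3 k (by omega)
        refine ⟨N', hN', (sub_col hN y).trans hs, z, Multiset.mem_of_mem_erase hz, ?_, ?_⟩
        · simp only [e1]; congr 1; push_cast; ring
        · simp only [e2]; congr 1; push_cast; ring
    · intro k hk
      cases k with
      | zero =>
        obtain ⟨N', hN', hs, z, hz, e1, e2⟩ := h3 0 (by omega)
        simp only [e2]
        have := hmax z (Multiset.mem_toFinset.mpr (Multiset.mem_of_mem_erase hz))
        refine le_trans ?_ this
        have h5 := hh_anti ((sub_col hN y).trans hs) (Y.erase z) e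
        simpa using h5
      | succ k => exact h4 k (by omega)

lemma exists_Q {n : ℕ} (Y : Finset (Fin n)) (hY : Y.Nonempty) : ∀ q : ℕ, ∀ u : Fin n → ℕ,
    (∀ j, j ∉ Y → u j = 0) → dg u ≤ q → ∃ Q : Multiset (Fin n), Q.card = q ∧ (∀ y ∈ Q, y ∈ Y) ∧
      u ≤ (Q.map (fun y => (Pi.single y 1 : Fin n → ℕ))).sum := by
  intro q
  induction q with
  | zero =>
    intro u _ hu
    refine ⟨0, by simp, by simp, fun i => ?_⟩
    have := le_dg u i
    simp; omega
  | succ q ih =>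
    intro u hs hu
    by_cases h : u = 0
    · obtain ⟨y, hy⟩ := hY
      obtain ⟨Q, h1, h2, h3⟩ := ih 0 (by simp) (by simp [dg])
      refine ⟨y ::ₘ Q, by simp [h1], ?_, ?_⟩
      · intro z hz
        rcases Multiset.mem_cons.mp hz with rfl | hz
        · exact hy
        · exact h2 z hz
      · rw [h]; exact zero_le
    · obtain ⟨i, hi⟩ := Function.ne_iff.mp h
      have hi : u i ≠ 0 := hi
      have hiY : i ∈ Y := by by_contra hc; exact hi (hs i hc)
      obtain ⟨Q, h1, h2, h3⟩ := ih (update u i (u i - 1)) (by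
        intro j hj
        have : j ≠ i := fun h => hj (h ▸ hiY)
        simp [this, hs j hj]) (by rw [dg_update]; push_cast at hu; omega)
      refine ⟨i ::ₘ Q, by simp [h1], ?_, ?_⟩
      · intro z hz
        rcases Multiset.mem_cons.mp hz with rfl | hz
        · exact hiY
        · exact h2 z hz
      · rw [Multiset.map_cons, Multiset.sum_cons]
        intro k
        have := h3 k
        by_cases hk : k = i
        · subst hk; simp at this ⊢; omega
        · simp [hk] at this ⊢; omega

noncomputable def box {n : ℕ} (a : Fin n → ℕ) (B : Finset (Fin n)) : Fin n → ℕ :=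
  fun i => if i ∈ B then a i else 1

theorem MON {n : ℕ} (a : Fin n → ℕ) (ha : Monotone a) : ∀ m : ℕ, ∀ B Y : Finset (Fin n),
    B.card = m → Y.card = m → ∀ N : Set (Fin n → ℕ), IsUpperSet N →
    (∀ i ∈ B, ∀ F ⊆ Y, F.card < (B.filter (fun j => j ≤ i)).card →
      ∃ u ∈ N, (∀ j, j ∉ Y ∨ j ∈ F → u j = 0) ∧ dg u ≤ a i) →
    ∀ d : ℤ, ∃ A ⊆ PP (box a B) d, A.card + hh N Y d = (PP (box a B) d).card ∧
      (up (box a B) A).card + hh N Y (d + 1) ≤ (PP (box a B) (d + 1)).card := by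
  intro m
  induction m with
  | zero =>
    intro B Y hB hY N _ _ d
    rw [Finset.card_eq_zero] at hB hY
    subst hB hY
    have hPm : ∀ e, PP (box a ∅) e = mon ∅ e := by
      intro e
      ext u
      simp [mem_PP, mem_mon, box]
    refine ⟨(PP (box a ∅) d).filter (fun u => u ∈ N), filter_subset _ _, ?_, ?_⟩
    · rw [hh, ← hPm]
      exact Finset.card_filter_add_card_filter_not _
    · have : up (box a ∅) ((PP (box a ∅) d).filter (fun u => u ∈ N)) = ∅ := by
        rw [Finset.eq_empty_iff_forall_notMem]
        intro w hw
        obtain ⟨h1, u, _, j, hj⟩ := mem_up.mp hw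
        have := h1 j
        rw [hj] at this
        simp [box] at this
      rw [this, hh, ← hPm]
      simpa using card_le_card (filter_subset _ _)
  | succ m ih =>
    intro B Y hB hY N hN hH d
    have hBne : B.Nonempty := by rw [← Finset.card_pos]; omega
    have hYne : Y.Nonempty := by rw [← Finset.card_pos]; omega
    set i0 := B.min' hBne with hi0
    have hi0B : i0 ∈ B := Finset.min'_mem _ _
    have hi0le : ∀ j ∈ B, i0 ≤ j := fun j hj => Finset.min'_le _ _ hj
    obtain ⟨u, huN, hu0, hud⟩ := hH i0 hi0B ∅ (by simp) (by
      rw [Finset.card_empty, Finset.card_pos]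
      exact ⟨i0, by simp [hi0B]⟩)
    obtain ⟨Q, hQc, hQY, hQu⟩ := exists_Q Y hYne (a i0) u (fun j hj => hu0 j (Or.inl hj)) hud
    obtain ⟨H, H', hs, hs', hk1, hk2⟩ := greedy Y (a i0) Q hQc hQY N hN (hN hQu huN) d
    have hbi : box a B i0 = a i0 := by simp [box, hi0B]
    have hbu : update (box a B) i0 1 = box a (B.erase i0) := by
      ext j
      by_cases hj : j = i0
      · rw [hj]; simp [box]
      · simp [box, hj]
    have key : ∀ k < a i0, ∃ A ⊆ PP (box a (B.erase i0)) (d - k),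
        A.card + H k = (PP (box a (B.erase i0)) (d - k)).card ∧
        (up (box a (B.erase i0)) A).card + H' k ≤
          (PP (box a (B.erase i0)) (d + 1 - k)).card := by
      intro k hk
      obtain ⟨N', hN', hsub, y, hy, e1, e2⟩ := hk1 k hk
      have hyY := hQY y hy
      obtain ⟨A, hA, h1, h2⟩ := ih (B.erase i0) (Y.erase y)
        (by rw [Finset.card_erase_of_mem hi0B, hB]; rfl)
        (by rw [Finset.card_erase_of_mem hyY, hY]; rfl) N' hN' (by
          intro i hi F hF hFc
          have hiB := Finset.mem_of_mem_erase hi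
          obtain ⟨w, hw, hw0, hwd⟩ := hH i hiB (insert y F) (by
            intro j hj
            rcases Finset.mem_insert.mp hj with rfl | hj
            · exact hyY
            · exact Finset.mem_of_mem_erase (hF hj)) (by
            have e3 : (B.erase i0).filter (fun j => j ≤ i) =
                (B.filter (fun j => j ≤ i)).erase i0 := by
              ext j; simp; tauto
            rw [e3, Finset.card_erase_of_mem (by simp [hi0B, hi0le i hiB])] at hFc
            have := Finset.card_insert_le y F
            omega)
          refine ⟨w, hsub hw, fun j hj => hw0 j ?_, hwd⟩
          rcases hj with hj | hj
          · rw [Finset.mem_erase, not_and_or, not_not] at hj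
            rcases hj with rfl | hj
            · right; simp
            · left; exact hj
          · right; simp [hj]) (d - k)
      refine ⟨A, hA, by rw [e1]; exact h1, ?_⟩
      rw [e2]
      rw [show d + 1 - (k : ℤ) = d - k + 1 by ring]
      exact h2
    set p : ℤ → ℕ := fun e => (PP (box a (B.erase i0)) e).card with hp
    have hHp : ∀ k < a i0, H k ≤ p (d - k) ∧ H' k ≤ p (d + 1 - k) := by
      intro k hk
      obtain ⟨A, hA, h1, h2⟩ := key k hk
      simp only [hp]
      omega
    have hcardC : ∀ k : ℕ, (seg (PP (box a (B.erase i0)) (d - k)) (p (d - k) - H k)).card =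
        p (d - k) - H k := fun k => seg_card (Nat.sub_le _ _)
    obtain ⟨A, hA, _, hAc, hAu⟩ := build (box a B) i0 d
      (fun k => seg (PP (box a (B.erase i0)) (d - k)) (p (d - k) - H k))
      (fun k => p (d + 1 - k) - H' k)
      (by intro k _; rw [hbu]; exact seg_UC _ _ _)
      (by
        intro k hk
        rw [hbi] at hk
        rw [hbu]
        obtain ⟨A, hA, h1, h2⟩ := key k hk
        have hAc : A.card = p (d - k) - H k := by simp only [hp]; omega
        have := CL _ (box a (B.erase i0)) rfl (by
          intro i j hij h1 h2
          simp only [box] at h1 h2 ⊢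
          split_ifs at h1 h2 ⊢ with h3 h4
          · exact ha hij.le
          all_goals omega) (d - k) A hA
        rw [hAc] at this
        simp only [hp] at this ⊢
        omega)
      (by
        intro k hk
        rw [hbi] at hk
        rw [hcardC]
        have := hk2 k hk
        rw [show d + 1 - ((k + 1 : ℕ) : ℤ) = d - k by push_cast; ring]
        omega)
    refine ⟨A, hA, ?_, ?_⟩
    · rw [hAc, hs, card_PP i0, hbi, hbu, ← Finset.sum_add_distrib]
      apply Finset.sum_congr rfl
      intro k hk
      rw [hcardC]
      exact Nat.sub_add_cancel (hHp k (mem_range.mp hk)).1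
    · rw [hs', card_PP i0, hbi, hbu]
      rw [hbi] at hAu
      refine (Nat.add_le_add_right hAu _).trans ?_
      rw [← Finset.sum_add_distrib]
      apply le_of_eq
      apply Finset.sum_congr rfl
      intro k hk
      exact Nat.sub_add_cancel (hHp k (mem_range.mp hk)).2

/-- final combinatorial growth statement -/
theorem growth {n : ℕ} (a : Fin n → ℕ) (ha : Monotone a) (N : Set (Fin n → ℕ)) (hN : IsUpperSet N)
    (hH : ∀ i : Fin n, ∀ F : Finset (Fin n), F.card ≤ i.val →
      ∃ u ∈ N, (∀ j ∈ F, u j = 0) ∧ dg u ≤ a i) (d : ℤ) :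
    hh N univ d ≤ (PP a d).card ∧
    up a (seg (PP a d) ((PP a d).card - hh N univ d)) ⊆
      seg (PP a (d + 1)) ((PP a (d + 1)).card - hh N univ (d + 1)) := by
  have hbox : box a univ = a := by ext i; simp [box]
  obtain ⟨A, hA, h1, h2⟩ := MON a ha n univ univ (by simp) (by simp) N hN (by
    intro i _ F _ hF
    have : (univ.filter (fun j => j ≤ i)).card = i.val + 1 := by
      have : univ.filter (fun j => j ≤ i) = Finset.Iic i := by ext; simp
      rw [this, Fin.card_Iic]
    rw [this] at hF
    obtain ⟨u, hu, h1, h2⟩ := hH i F (by omega)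
    exact ⟨u, hu, fun j hj => h1 j (by simpa using hj), h2⟩) d
  rw [hbox] at hA h1 h2
  refine ⟨by omega, ?_⟩
  apply UC_subset (up_UC (seg_UC _ _ _)) (seg_UC _ _ _)
  rw [seg_card (Nat.sub_le _ _)]
  have := CL _ a rfl (fun i j hij _ _ => ha hij.le) d A hA
  have hAc : A.card = (PP a d).card - hh N univ d := by omega
  rw [hAc] at this
  omega

end EGH


namespace EGH
open Finset Function
open scoped Classical

lemma reg_height {R : Type*} [CommRing R] (rs : List R)
    (h : RingTheory.Sequence.IsWeaklyRegular R rs) :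
    ∀ k ≤ rs.length, ∀ Q : Ideal R, Q.IsPrime → (∀ r ∈ rs.take k, r ∈ Q) → (k : ℕ∞) ≤ Q.height := by
  intro k
  induction k with
  | zero => intro _ Q _ _; simp
  | succ k ih =>
    intro hk Q hQ hQr
    have hk' : k < rs.length := hk
    have hle : Ideal.ofList (rs.take k) ≤ Q := by
      rw [Ideal.ofList, Ideal.span_le]
      intro r hr
      exact hQr r (List.take_subset_take_left rs (Nat.le_succ k) hr)
    obtain ⟨P, hP, hPQ⟩ := Ideal.exists_minimalPrimes_le hle
    have hPp : P.IsPrime := hP.1.1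
    have hreg := h.regular_mod_prev k hk'
    have hnot : rs[k] ∉ P := by
      apply hreg.notMem_of_mem_minimalPrimes
      have : Module.annihilator R (R ⧸ (Ideal.ofList (rs.take k) • ⊤ : Submodule R R)) =
          Ideal.ofList (rs.take k) := by
        rw [smul_eq_mul, Ideal.mul_top]
        exact Ideal.annihilator_quotient
      rw [this]
      exact hP
    have hlt : P < Q := lt_of_le_of_ne hPQ (by
      rintro rfl
      exact hnot (hQr _ (by
        rw [List.mem_take_iff_getElem]
        exact ⟨k, by omega, rfl⟩)))
    have h1 := ih hk'.le P hPp (fun r hr => hP.1.2 (Ideal.subset_span hr))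
    have h2 := Ideal.height_add_one_le_of_lt_of_isPrime hlt
    push_cast
    exact le_trans (by gcongr) h2

lemma dg_finsupp {n : ℕ} (m : Fin n →₀ ℕ) : dg (m : Fin n → ℕ) = (m.degree : ℤ) := by
  rw [Finsupp.degree_eq_sum]
  simp [dg]

lemma exists_low {n t : ℕ} (K : Type*) [Field K] (M : Ideal (MvPolynomial (Fin n) K))
    (E : Set (Fin n → ℕ)) (hE : ∀ p, p ∈ M ↔ ∀ m ∈ p.support, (m : Fin n → ℕ) ∈ E)
    (a : Fin t → ℕ) (ha : Monotone a)
    (f : Fin t → MvPolynomial (Fin n) K)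
    (hfM : ∀ i, f i ∈ M)
    (hfhom : ∀ i, (f i).IsHomogeneous (a i))
    (hfreg : RingTheory.Sequence.IsRegular (MvPolynomial (Fin n) K) (List.ofFn f))
    (i : Fin t) (F : Finset (Fin n)) (hF : F.card ≤ i.val) :
    ∃ u ∈ E, (∀ j ∈ F, u j = 0) ∧ dg u ≤ a i := by
  by_contra hcon
  push Not at hcon
  set P : Ideal (MvPolynomial (Fin n) K) :=
    Ideal.span (((F.image X : Finset (MvPolynomial (Fin n) K))) : Set (MvPolynomial (Fin n) K)) with hP
  have hPX : P = Ideal.span (X '' (F : Set (Fin n))) := by rw [hP, Finset.coe_image]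
  have hmem : ∀ k ≤ i, f k ∈ P := by
    intro k hk
    rw [hPX, mem_ideal_span_X_image]
    intro m hm
    by_contra hc
    push Not at hc
    have h1 := hcon m ((hE _).1 (hfM k) m hm) (fun j hj => hc j hj)
    rw [dg_finsupp] at h1
    have h2 := hfhom k (mem_support_iff.1 hm)
    rw [Pi.one_def, ← Finsupp.degree_eq_weight_one] at h2
    have h3 := ha hk
    omega
  have hPtop : P ≠ ⊤ := by
    rw [hPX, Ne, Ideal.eq_top_iff_one, mem_ideal_span_X_image]
    intro h
    obtain ⟨j, _, hj⟩ := h 0 (by simp)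
    simp at hj
  obtain ⟨Q, hQ⟩ := Ideal.nonempty_minimalPrimes hPtop
  have h1 := Ideal.height_le_card_of_mem_minimalPrimes_span_finset hQ
  have h2 := reg_height _ hfreg.toIsWeaklyRegular (i.val + 1) (by simp) Q hQ.1.1 (by
    intro r hr
    apply hQ.1.2
    rw [List.mem_take_iff_getElem] at hr
    obtain ⟨k, hk, rfl⟩ := hr
    rw [List.getElem_ofFn]
    apply hmem
    rw [Fin.le_def]
    simp at hk ⊢
    omega)
  have h3 := h2.trans h1
  have h4 : i.val + 1 ≤ (F.image (X : Fin n → MvPolynomial (Fin n) K)).card := by exact_mod_cast h3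
  have h5 := Finset.card_image_le (s := F) (f := (X : Fin n → MvPolynomial (Fin n) K))
  omega

end EGH


namespace EGH
open Finset Function
open scoped Classical

noncomputable def ext {n t : ℕ} (a : Fin t → ℕ) (N : ℕ) (i : Fin n) : ℕ :=
  if h : i.val < t then a ⟨i.val, h⟩ else N

lemma ext_lt {n t : ℕ} {htn : t ≤ n} {a : Fin t → ℕ} {N : ℕ} {u : Fin n → ℕ} (hu : dg u < N) :
    (∀ i, u i < ext a N i) ↔ ∀ i : Fin t, u (Fin.castLE htn i) < a i := by
  constructor
  · intro h i
    have := h (Fin.castLE htn i)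
    simpa [ext] using this
  · intro h i
    unfold ext
    split_ifs with hi
    · exact h ⟨i, hi⟩
    · have := le_dg u i
      omega

noncomputable def Pd {n t : ℕ} (htn : t ≤ n) (a : Fin t → ℕ) (d : ℤ) : Finset (Fin n → ℕ) :=
  (mon univ d).filter (fun u => ∀ i : Fin t, u (Fin.castLE htn i) < a i)

lemma PP_ext {n t : ℕ} (htn : t ≤ n) (a : Fin t → ℕ) {N : ℕ} {d : ℤ} (hd : d < N) :
    PP (ext a N) d = Pd (n := n) htn a d := by
  ext u
  simp only [mem_PP, Pd, mem_filter, mem_mon]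
  constructor
  · rintro ⟨h1, h2⟩
    exact ⟨⟨by simp, h2⟩, (ext_lt (by omega)).1 h1⟩
  · rintro ⟨⟨_, h2⟩, h1⟩
    exact ⟨(ext_lt (by omega)).2 h1, h2⟩

lemma hh_congr {n : ℕ} {E E' : Set (Fin n → ℕ)} {e : ℤ} (h : ∀ u, dg u = e → (u ∈ E ↔ u ∈ E')) :
    hh E univ e = hh E' univ e := by
  unfold hh
  congr 1
  apply Finset.filter_congr
  intro u hu
  rw [mem_mon] at hu
  rw [h u hu.2]

lemma growth' {n t : ℕ} (htn : t ≤ n) (a : Fin t → ℕ) (ha : Monotone a) (E : Set (Fin n → ℕ))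
    (hE : IsUpperSet E)
    (hH : ∀ i : Fin t, ∀ F : Finset (Fin n), F.card ≤ i.val →
      ∃ u ∈ E, (∀ j ∈ F, u j = 0) ∧ dg u ≤ a i) (d : ℤ) :
    hh E univ d ≤ (Pd htn a d).card ∧
    ∀ u ∈ seg (Pd htn a d) ((Pd htn a d).card - hh E univ d), ∀ j,
      (∀ i : Fin t, (u + Pi.single j 1 : Fin n → ℕ) (Fin.castLE htn i) < a i) →
      u + Pi.single j 1 ∈
        seg (Pd htn a (d + 1)) ((Pd htn a (d + 1)).card - hh E univ (d + 1)) := by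
  set N : ℕ := d.toNat + 2 + ∑ i, a i with hN
  have hNd : d + 1 < N := by
    rw [hN]; push_cast
    have := Int.self_le_toNat d
    have : (0 : ℤ) ≤ ∑ i, (a i : ℤ) := Finset.sum_nonneg (fun _ _ => by positivity)
    omega
  have haN : ∀ i, a i ≤ N := by
    intro i
    have := Finset.single_le_sum (f := a) (fun _ _ => Nat.zero_le _) (mem_univ i)
    omega
  set E' : Set (Fin n → ℕ) := E ∪ {u | (N : ℤ) ≤ dg u} with hE'
  have hup : IsUpperSet E' := by
    intro u v huv hu
    rcases hu with hu | hu
    · exact Or.inl (hE huv hu)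
    · right
      have : dg u ≤ dg v := Finset.sum_le_sum (fun i _ => by exact_mod_cast huv i)
      exact le_trans hu this
  have hmono : Monotone (ext (n := n) a N) := by
    intro i j hij
    unfold ext
    split_ifs with h1 h2
    · exact ha hij
    · exact haN _
    · have := Fin.le_def.1 hij
      omega
    · exact le_refl _
  have hhE : ∀ e : ℤ, e < N → hh E' univ e = hh E univ e := by
    intro e he
    apply hh_congr
    intro u hu
    have : ¬ ((N : ℤ) ≤ dg u) := by omega
    simp [hE', this]
  have key := growth (ext a N) hmono E' hup (by
    intro i F hF
    by_cases hi : i.val < t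
    · obtain ⟨u, hu, h1, h2⟩ := hH ⟨i.val, hi⟩ F hF
      refine ⟨u, Or.inl hu, h1, ?_⟩
      simpa [ext, hi] using h2
    · have : ∃ j, j ∉ F := by
        by_contra hc
        push Not at hc
        have : F = univ := by ext j; simp [hc j]
        rw [this, Finset.card_univ, Fintype.card_fin] at hF
        have := i.isLt
        omega
      obtain ⟨j, hj⟩ := this
      refine ⟨Pi.single j N, Or.inr (by simp [dg_single]), ?_, ?_⟩
      · intro k hk
        have : k ≠ j := by rintro rfl; exact hj hk
        simp [Pi.single_apply, this]
      · simp [dg_single, ext, hi]) d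
  rw [PP_ext htn a (by omega : d < N), PP_ext htn a hNd, hhE d (by omega), hhE _ hNd] at key
  refine ⟨key.1, fun u hu j hj => key.2 ?_⟩
  rw [mem_up]
  refine ⟨(ext_lt (htn := htn) ?_).2 hj, u, hu, j, rfl⟩
  have := seg_subset _ _ hu
  rw [Pd, mem_filter, mem_mon] at this
  rw [dg_add, dg_single, this.1.2]
  push_cast
  exact hNd

lemma upper_of_step {n : ℕ} (J : Set (Fin n → ℕ)) (h : ∀ u ∈ J, ∀ j, u + Pi.single j 1 ∈ J) :
    IsUpperSet J := by
  have key : ∀ k : ℕ, ∀ w : Fin n → ℕ, ∑ i, w i = k → ∀ u ∈ J, u + w ∈ J := by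
    intro k
    induction k with
    | zero =>
      intro w hw u hu
      have : w = 0 := by
        ext i
        simpa using (Finset.sum_eq_zero_iff.1 hw) i (mem_univ i)
      rw [this, add_zero]
      exact hu
    | succ k ih =>
      intro w hw u hu
      have : ∃ j, w j ≠ 0 := by
        by_contra hc
        push Not at hc
        simp [hc] at hw
      obtain ⟨j, hj⟩ := this
      have hle : Pi.single j 1 ≤ w := by
        intro i
        by_cases hi : i = j
        · subst hi; simp; omega
        · simp [Pi.single_apply, hi]
      have hw' : w = (w - Pi.single j 1) + Pi.single j 1 := (tsub_add_cancel_of_le hle).symm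
      rw [hw', ← add_assoc]
      apply h
      apply ih _ _ _ hu
      have h2 := hw
      rw [hw'] at h2
      simp only [Pi.add_apply, Finset.sum_add_distrib] at h2
      rw [Finset.sum_pi_single'] at h2
      simp at h2
      simpa using h2
  intro u v huv hu
  have := key _ (v - u) rfl u hu
  rwa [add_tsub_cancel_of_le huv] at this

theorem assemble {n t : ℕ} (htn : t ≤ n) (a : Fin t → ℕ) (ha : Monotone a) (E : Set (Fin n → ℕ))
    (hE : IsUpperSet E)
    (hH : ∀ i : Fin t, ∀ F : Finset (Fin n), F.card ≤ i.val →
      ∃ u ∈ E, (∀ j ∈ F, u j = 0) ∧ dg u ≤ a i) :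
    ∃ J : Set (Fin n → ℕ), IsUpperSet J ∧
      (∀ i : Fin t, ∀ u : Fin n → ℕ, a i ≤ u (Fin.castLE htn i) → u ∈ J) ∧
      ∀ d : ℤ, hh J univ d = hh E univ d := by
  set s : ℤ → Finset (Fin n → ℕ) :=
    fun d => seg (Pd htn a d) ((Pd htn a d).card - hh E univ d) with hs
  set J : Set (Fin n → ℕ) :=
    {u | (∃ i : Fin t, a i ≤ u (Fin.castLE htn i)) ∨ u ∈ s (dg u)} with hJ
  refine ⟨J, upper_of_step J ?_, fun i u h => Or.inl ⟨i, h⟩, ?_⟩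
  · rintro u (⟨i, hi⟩ | hu) j
    · exact Or.inl ⟨i, hi.trans (by simp)⟩
    · by_cases hc : ∃ i : Fin t, a i ≤ (u + Pi.single j 1 : Fin n → ℕ) (Fin.castLE htn i)
      · exact Or.inl hc
      · push Not at hc
        right
        have := (growth' htn a ha E hE hH (dg u)).2 u hu j hc
        rw [dg_add, dg_single]
        exact this
  · intro d
    have hle := (growth' htn a ha E hE hH d).1
    have : hh J univ d = (Pd htn a d \ s d).card := by
      unfold hh
      congr 1
      ext u
      simp only [mem_filter, mem_sdiff, Pd, hJ, Set.mem_ofPred_eq, mem_mon, not_or, not_exists, not_le]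
      constructor
      · rintro ⟨h1, h2, h3⟩
        rw [h1.2] at h3
        exact ⟨⟨h1, h2⟩, h3⟩
      · rintro ⟨⟨h1, h2⟩, h3⟩
        refine ⟨h1, h2, ?_⟩
        rw [h1.2]
        exact h3
    rw [this, Finset.card_sdiff_of_subset (seg_subset _ _), seg_card (Nat.sub_le _ _)]
    omega

end EGH

namespace EGH
open Finset Function
open scoped Classical

lemma hilbert_eq {n : ℕ} (K : Type*) [Field K] (I : Ideal (MvPolynomial (Fin n) K))
    (E : Set (Fin n → ℕ)) (hE : ∀ p, p ∈ I ↔ ∀ m ∈ p.support, (m : Fin n → ℕ) ∈ E) (d : ℕ) :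
    hilbertFn K I d = hh E univ d := by
  set T := (mon (univ : Finset (Fin n)) (d : ℤ)).filter (fun u => u ∉ E) with hT
  let φ : ↥(homogeneousSubmodule (Fin n) K d) →ₗ[K] (T → K) :=
    { toFun := fun p u => coeff (Finsupp.equivFunOnFinite.symm u.1) p.1
      map_add' := by intro p q; ext u; simp
      map_smul' := by intro c p; ext u; simp }
  have hker : LinearMap.ker φ = Submodule.comap (homogeneousSubmodule (Fin n) K d).subtype
        (Submodule.restrictScalars K I) := by
    ext p
    rw [LinearMap.mem_ker, Submodule.mem_comap, Submodule.restrictScalars_mem, hE]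
    constructor
    · intro h m hm
      by_contra hc
      have hd : dg (m : Fin n → ℕ) = d := by
        have h2 := (mem_homogeneousSubmodule _ _).1 p.2 (mem_support_iff.1 hm)
        rw [Pi.one_def, ← Finsupp.degree_eq_weight_one] at h2
        rw [dg_finsupp, h2]
      have hmT : (m : Fin n → ℕ) ∈ T := by
        rw [hT, mem_filter, mem_mon]
        exact ⟨⟨by simp, hd⟩, hc⟩
      have h3 := congrFun h ⟨m, hmT⟩
      have h4 : Finsupp.equivFunOnFinite.symm (m : Fin n → ℕ) = m := by ext; simp
      change coeff (Finsupp.equivFunOnFinite.symm (m : Fin n → ℕ)) p.1 = 0 at h3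
      rw [h4] at h3
      exact mem_support_iff.1 hm h3
    · intro h
      ext u
      change coeff (Finsupp.equivFunOnFinite.symm u.1) p.1 = 0
      by_contra hc
      have h1 := h _ (mem_support_iff.2 hc)
      have h2 := (mem_filter.1 u.2).2
      exact h2 (by simpa using h1)
  have hsurj : Function.Surjective φ := by
    intro g
    refine ⟨⟨∑ u : T, monomial (Finsupp.equivFunOnFinite.symm u.1) (g u), ?_⟩, ?_⟩
    · apply Submodule.sum_mem
      intro u _
      rw [mem_homogeneousSubmodule]
      apply isHomogeneous_monomial
      have h1 := (mem_mon.1 (mem_filter.1 u.2).1).2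
      have h2 := dg_finsupp (Finsupp.equivFunOnFinite.symm u.1)
      simp only [Finsupp.equivFunOnFinite_symm_apply_apply, Finsupp.coe_equivFunOnFinite_symm] at h2
      rw [h1] at h2
      exact_mod_cast h2.symm
    · ext v
      change coeff (Finsupp.equivFunOnFinite.symm v.1)
        (∑ u : T, monomial (Finsupp.equivFunOnFinite.symm u.1) (g u)) = g v
      rw [coeff_sum, Finset.sum_eq_single v]
      · simp
      · intro b _ hb
        rw [coeff_monomial, if_neg]
        intro hc
        exact hb (Subtype.ext (Finsupp.equivFunOnFinite.symm.injective hc))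
      · simp
  unfold hilbertFn
  rw [← hker, (φ.quotKerEquivOfSurjective hsurj).finrank_eq]
  simp [hh, hT]

lemma monomial_mem {n : ℕ} (K : Type*) [Field K] (G : Set (Fin n →₀ ℕ))
    (p : MvPolynomial (Fin n) K) :
    p ∈ Ideal.span ((fun s => (monomial s (1 : K))) '' G) ↔
      ∀ m ∈ p.support, (m : Fin n → ℕ) ∈ {u : Fin n → ℕ | ∃ s ∈ G, (s : Fin n → ℕ) ≤ u} := by
  rw [mem_ideal_span_monomial_image]
  rfl

end EGH

/-- **Corollary 22 of the paper (EGH for monomial ideals containing a regular sequence).**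
If `M` is a monomial ideal containing a homogeneous regular sequence `f₁,…,f_t` with
`deg fᵢ = aᵢ`, `a₁ ≤ ⋯ ≤ a_t`, then `M` has the same Hilbert function as a monomial ideal
containing `x₁^{a₁},…,x_t^{a_t}`. -/
theorem egh_for_monomial_ideals
    {n t : ℕ} (htn : t ≤ n) (K : Type*) [Field K]
    (M : Ideal (MvPolynomial (Fin n) K)) (hM : IsMonomialIdeal M)
    (a : Fin t → ℕ) (ha : Monotone a)
    (f : Fin t → MvPolynomial (Fin n) K)
    (hfM : ∀ i, f i ∈ M)
    (hfhom : ∀ i, (f i).IsHomogeneous (a i))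
    (hfreg : RingTheory.Sequence.IsRegular (MvPolynomial (Fin n) K) (List.ofFn f)) :
    ∃ J : Ideal (MvPolynomial (Fin n) K), IsMonomialIdeal J ∧
      (∀ i : Fin t, (X (Fin.castLE htn i) : MvPolynomial (Fin n) K) ^ a i ∈ J) ∧
      ∀ d : ℕ, hilbertFn K J d = hilbertFn K M d := by
  obtain ⟨G, rfl⟩ := hM
  set E : Set (Fin n → ℕ) := {u : Fin n → ℕ | ∃ s ∈ G, (s : Fin n → ℕ) ≤ u} with hE
  have hup : IsUpperSet E := by
    rintro u v huv ⟨s, hs, h⟩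
    exact ⟨s, hs, h.trans huv⟩
  obtain ⟨J, hJ, h1, h2⟩ := EGH.assemble htn a ha E hup
    (fun i F hF => EGH.exists_low K _ E (EGH.monomial_mem K G) a ha f hfM hfhom hfreg i F hF)
  have hJm : ∀ p : MvPolynomial (Fin n) K,
      p ∈ Ideal.span ((fun s => (monomial s (1 : K))) '' {s : Fin n →₀ ℕ | (s : Fin n → ℕ) ∈ J}) ↔
      ∀ m ∈ p.support, (m : Fin n → ℕ) ∈ J := by
    intro p
    rw [EGH.monomial_mem]
    refine forall₂_congr (fun m _ => ⟨?_, fun h => ⟨m, h, le_refl _⟩⟩)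
    rintro ⟨s, hs, h⟩
    exact hJ h hs
  refine ⟨_, ⟨{s | (s : Fin n → ℕ) ∈ J}, rfl⟩, ?_, ?_⟩
  · intro i
    rw [hJm]
    intro m hm
    rw [X_pow_eq_monomial] at hm
    have := support_monomial_subset hm
    rw [Finset.mem_singleton] at this
    subst this
    exact h1 i _ (by simp)
  · intro d
    rw [EGH.hilbert_eq K _ J hJm, EGH.hilbert_eq K _ E (EGH.monomial_mem K G), h2]
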